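/- arXiv:1403.2224 — 10 statements merged into one kernel-verified Lean document; each statement's English description precedes it below -/
import Mathlib

section
/- Let G be a group, let i, j ∈ G satisfy i² = 1, j² = 1 and i·j = j·i, and set k = i·j. Let g ∈ G be arbitrary. Suppose that h₁ = i·(g⁻¹·j·g) has odd order m₁; set n₁ = h₁^((m₁+1)/2) and s = (g·n₁⁻¹)⁻¹·k·(g·n₁⁻¹). Suppose further that h₂ = j·s has odd order m₂; set n₂ = h₂^((m₂+1)/2) and x = g·n₁⁻¹·n₂⁻¹. Then x⁻¹·i·x = k, x⁻¹·j·x = i and x⁻¹·k·x = j; in particular x normalizes the subgroup generated by i and j. -/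
/-- Conjugation by `x` preserves `closure S` as soon as it sends `S` into `closure S`. -/
theorem conj_mem_closure {G : Type*} [Group G] {S : Set G} {x : G}
    (hS : ∀ a ∈ S, x * a * x⁻¹ ∈ Subgroup.closure S) {a : G} (ha : a ∈ Subgroup.closure S) :
    x * a * x⁻¹ ∈ Subgroup.closure S := by
  have hle : Subgroup.closure S ≤ (Subgroup.closure S).comap (MulAut.conj x).toMonoidHom :=
    (Subgroup.closure_le _).2 hS
  exact hle ha

/-- If `a` and `b` are involutions whose product has odd order, then a power of `a * b`
conjugates `b` to `a`. -/
theorem pow_mul_conj_of_odd_orderOf {G : Type*} [Group G] {a b : G}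
    (ha : a ^ 2 = 1) (hb : b ^ 2 = 1) (hodd : Odd (orderOf (a * b))) :
    (a * b) ^ ((orderOf (a * b) + 1) / 2) * b *
      ((a * b) ^ ((orderOf (a * b) + 1) / 2))⁻¹ = a := by
  have ha' : a⁻¹ = a := inv_eq_of_mul_eq_one_left (by rw [← sq, ha])
  have hb' : b⁻¹ = b := inv_eq_of_mul_eq_one_left (by rw [← sq, hb])
  have hinv : SemiconjBy b (a * b)⁻¹ (a * b) := by
    rw [SemiconjBy, mul_inv_rev, ha', hb', ← mul_assoc, ← sq, hb, one_mul, mul_assoc, ← sq, hb,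
      mul_one]
  have hsq : (a * b) ^ ((orderOf (a * b) + 1) / 2) * (a * b) ^ ((orderOf (a * b) + 1) / 2) =
      a * b := by
    rw [← pow_add, ← two_mul, Nat.mul_div_cancel' (by have := hodd; grind), pow_succ,
      pow_orderOf_eq_one, one_mul]
  have hpow := hinv.pow_right ((orderOf (a * b) + 1) / 2)
  rw [inv_pow] at hpow
  rw [mul_assoc, hpow.eq, ← mul_assoc, hsq, mul_assoc, ← sq, hb, mul_one]


/-- Lemma 2.2 of the paper (group-theoretic part): given commuting involutions
`i`, `j` with `k = i * j` and an arbitrary element `g`, if `h₁ = i * j^g` has odd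
order `m₁` and, with `n₁ = h₁ ^ ((m₁+1)/2)` and `s = k^(g * n₁⁻¹)`, the element
`h₂ = j * s` has odd order `m₂`, then `x = g * n₁⁻¹ * n₂⁻¹` (with
`n₂ = h₂ ^ ((m₂+1)/2)`) cyclically permutes `i`, `j`, `k` by conjugation; in
particular it normalizes `⟨i, j⟩`. -/
theorem elt_of_order_three_permutes {G : Type*} [Group G] (i j k : G)
    (hi : i ^ 2 = 1) (hj : j ^ 2 = 1) (hcomm : i * j = j * i) (hk : k = i * j)
    (g : G)
    (h₁ : G) (hh₁ : h₁ = i * (g⁻¹ * j * g))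
    (m₁ : ℕ) (hm₁ : m₁ = orderOf h₁) (hm₁odd : Odd m₁)
    (n₁ : G) (hn₁ : n₁ = h₁ ^ ((m₁ + 1) / 2))
    (s : G) (hs : s = (g * n₁⁻¹)⁻¹ * k * (g * n₁⁻¹))
    (h₂ : G) (hh₂ : h₂ = j * s)
    (m₂ : ℕ) (hm₂ : m₂ = orderOf h₂) (hm₂odd : Odd m₂)
    (n₂ : G) (hn₂ : n₂ = h₂ ^ ((m₂ + 1) / 2))
    (x : G) (hx : x = g * n₁⁻¹ * n₂⁻¹) :
    x⁻¹ * i * x = k ∧ x⁻¹ * j * x = i ∧ x⁻¹ * k * x = j ∧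
      x ∈ Subgroup.normalizer (Subgroup.closure {i, j}) := by
  subst hk hm₁ hm₂
  have hconj_sq : ∀ a y : G, a ^ 2 = 1 → (y⁻¹ * a * y) ^ 2 = 1 := fun a y ha => by
    simpa [ha] using conj_pow (i := 2) (a := y⁻¹) (b := a)
  have hk2 : (i * j) ^ 2 = 1 := by rw [Commute.mul_pow hcomm, hi, hj, one_mul]
  have hjy : (g * n₁⁻¹)⁻¹ * j * (g * n₁⁻¹) = i := by
    have h := pow_mul_conj_of_odd_orderOf hi (hconj_sq j g hj) (hh₁ ▸ hm₁odd)
    rw [← hh₁, ← hn₁] at h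
    simpa only [mul_inv_rev, inv_inv, mul_assoc] using h
  have hs2 : s ^ 2 = 1 := hs ▸ hconj_sq _ _ hk2
  have hsj : n₂ * s * n₂⁻¹ = j := by
    have h := pow_mul_conj_of_odd_orderOf hj hs2 (hh₂ ▸ hm₂odd)
    rwa [← hh₂, ← hn₂] at h
  have his : Commute i s := by
    have hjk : Commute j (i * j) := Commute.mul_right hcomm.symm rfl
    have h := (Commute.conj_iff (g * n₁⁻¹)⁻¹).2 hjk
    rwa [inv_inv, hjy, ← hs] at h
  have hin : Commute i n₂ := by
    rw [hn₂, hh₂]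
    exact (Commute.mul_right hcomm his).pow_right _
  have hxk : x⁻¹ * (i * j) * x = j := by
    refine Eq.trans ?_ hsj
    rw [hs, hx]
    group
  have hxj : x⁻¹ * j * x = i := by
    calc x⁻¹ * j * x = n₂ * ((g * n₁⁻¹)⁻¹ * j * (g * n₁⁻¹)) * n₂⁻¹ := by rw [hx]; group
      _ = i := by rw [hjy, ← hin.eq, mul_inv_cancel_right]
  have hxi : x⁻¹ * i * x = i * j := by
    have hji : j⁻¹ = j := inv_eq_of_mul_eq_one_left (by rw [← sq, hj])
    have hii : i⁻¹ = i := inv_eq_of_mul_eq_one_left (by rw [← sq, hi])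
    calc x⁻¹ * i * x = x⁻¹ * (i * j) * x * (x⁻¹ * j * x)⁻¹ := by group
      _ = i * j := by rw [hxk, hxj, hii, hcomm]
  refine ⟨hxi, hxj, hxk, ?_⟩
  have hi_mem : i ∈ Subgroup.closure {i, j} := Subgroup.subset_closure (by simp)
  have hj_mem : j ∈ Subgroup.closure {i, j} := Subgroup.subset_closure (by simp)
  have hfwd : ∀ a ∈ ({i, j} : Set G), x * a * x⁻¹ ∈ Subgroup.closure {i, j} := by
    rintro a (rfl | rfl)
    · have h : x * a * x⁻¹ = j := by nth_rw 1 [← hxj]; group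
      rwa [h]
    · have h : x * a * x⁻¹ = i * a := by nth_rw 1 [← hxk]; group
      rw [h]
      exact mul_mem hi_mem hj_mem
  have hbwd : ∀ a ∈ ({i, j} : Set G), x⁻¹ * a * x⁻¹⁻¹ ∈ Subgroup.closure {i, j} := by
    rintro a (rfl | rfl)
    · rw [inv_inv, hxi]
      exact mul_mem hi_mem hj_mem
    · rwa [inv_inv, hxj]
  refine Subgroup.mem_normalizer_iff.2 fun a => ⟨conj_mem_closure hfwd, fun ha => ?_⟩
  simpa [mul_assoc] using conj_mem_closure hbwd ha
end

section
/- Let q be an odd prime power and let G = PGL₂(𝔽_q). If i, j ∈ G are two distinct commuting involutions and V = ⟨i, j⟩ is the (Klein four-) subgroup they generate, then the centralizer of V in G equals V, i.e. {g ∈ G : g·i = i·g and g·j = j·g} = V. -/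
open Matrix

/-- `PGL₂(F)`: the quotient of `GL₂(F)` by its center. -/
abbrev PGL2 (F : Type*) [Field F] : Type _ :=
  GL (Fin 2) F ⧸ Subgroup.center (GL (Fin 2) F)

namespace PGL2

section TwoByTwo

variable {F : Type*} [Field F]

/-- The centralizer of a non-scalar `2 × 2` matrix `A` is spanned by `1` and `A`. -/
lemma exists_eq_smul_one_add_smul {A D : Matrix (Fin 2) (Fin 2) F}
    (hA : ∀ r : F, A ≠ r • 1) (h : A * D = D * A) : ∃ x y : F, D = x • 1 + y • A := by
  have h00 := congr_fun₂ h 0 0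
  have h01 := congr_fun₂ h 0 1
  have h10 := congr_fun₂ h 1 0
  simp only [Matrix.mul_apply, Fin.sum_univ_two] at h00 h01 h10
  by_cases hb : A 0 1 = 0
  · by_cases hc : A 1 0 = 0
    · have hd : A 0 0 - A 1 1 ≠ 0 := fun hd => hA (A 0 0) <| by
        ext i j
        fin_cases i <;> fin_cases j <;> simp [hb, hc]
        exact (sub_eq_zero.mp hd).symm
      refine ⟨D 0 0 - (D 0 0 - D 1 1) / (A 0 0 - A 1 1) * A 0 0,
        (D 0 0 - D 1 1) / (A 0 0 - A 1 1), ?_⟩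
      ext i j
      fin_cases i <;> fin_cases j <;> simp <;> field_simp <;> grind
    · refine ⟨D 0 0 - D 1 0 / A 1 0 * A 0 0, D 1 0 / A 1 0, ?_⟩
      ext i j
      fin_cases i <;> fin_cases j <;> simp <;> field_simp <;> grind
  · refine ⟨D 0 0 - D 0 1 / A 0 1 * A 0 0, D 0 1 / A 0 1, ?_⟩
    ext i j
    fin_cases i <;> fin_cases j <;> simp <;> field_simp <;> grind

/-- A non-scalar `2 × 2` matrix whose square is scalar has trace zero. -/
lemma trace_eq_zero_of_sq_scalar {A : Matrix (Fin 2) (Fin 2) F}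
    (hA : ∀ r : F, A ≠ r • 1) {s : F} (h : A * A = s • 1) : A.trace = 0 := by
  by_contra ht
  have h00 := congr_fun₂ h 0 0
  have h01 := congr_fun₂ h 0 1
  have h10 := congr_fun₂ h 1 0
  have h11 := congr_fun₂ h 1 1
  rw [Matrix.trace_fin_two] at ht
  simp [Matrix.mul_apply, Fin.sum_univ_two] at h00 h01 h10 h11
  have hb : A 0 1 = 0 := by grind
  have hc : A 1 0 = 0 := by grind
  have hd : A 1 1 = A 0 0 := by grind
  refine hA (A 0 0) ?_
  ext i j
  fin_cases i <;> fin_cases j <;> simp [hb, hc, hd]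

end TwoByTwo

section Projective

variable {F : Type*} [Field F]

lemma mem_center_iff {A : GL (Fin 2) F} :
    A ∈ Subgroup.center (GL (Fin 2) F) ↔ ∃ r : F, (A : Matrix (Fin 2) (Fin 2) F) = r • 1 := by
  rw [Matrix.GeneralLinearGroup.mem_center_iff_val_mem_range_scalar]
  simp [Set.mem_range, Matrix.smul_one_eq_diagonal, eq_comm]

/-- Matrices which commute in `PGL₂(F)` commute or anticommute. -/
lemma commute_or_anticommute {A B : GL (Fin 2) F}
    (h : (A : PGL2 F) * (B : PGL2 F) = (B : PGL2 F) * (A : PGL2 F)) :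
    A * B = B * A ∨ A * B = -(B * A) := by
  obtain ⟨u, hu⟩ := Matrix.ProjGenLinGroup.mk_eq_mk_iff.mp
    (show Matrix.ProjGenLinGroup.mk (B * A) = Matrix.ProjGenLinGroup.mk (A * B) from h.symm)
  have hdet : u ^ 2 = 1 := by
    have := congrArg Matrix.GeneralLinearGroup.det hu
    rw [map_mul, Matrix.GeneralLinearGroup.det_scalar, map_mul, map_mul,
      mul_comm (Matrix.GeneralLinearGroup.det A)] at this
    simpa using this
  have hu' : (u : F) = 1 ∨ (u : F) = -1 :=
    sq_eq_one_iff.mp (by rw [← Units.val_pow_eq_pow_val, hdet, Units.val_one])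
  rcases hu' with h1 | h1
  · left
    rw [← hu]
    ext i j
    simp [h1]
  · right
    rw [← hu]
    ext i j
    simp [h1]

lemma mk_eq_one {A : GL (Fin 2) F} :
    (A : PGL2 F) = 1 ↔ A ∈ Subgroup.center (GL (Fin 2) F) :=
  QuotientGroup.eq_one_iff A

lemma not_scalar_of_orderOf {A : GL (Fin 2) F} (hA : orderOf (A : PGL2 F) = 2) (r : F) :
    (A : Matrix (Fin 2) (Fin 2) F) ≠ r • 1 := fun h => by
  rw [mk_eq_one.mpr (mem_center_iff.mpr ⟨r, h⟩), orderOf_one] at hA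
  exact absurd hA (by norm_num)

lemma trace_eq_zero_of_orderOf {A : GL (Fin 2) F} (hA : orderOf (A : PGL2 F) = 2) :
    (A : Matrix (Fin 2) (Fin 2) F).trace = 0 := by
  have hsq : ((A * A : GL (Fin 2) F) : PGL2 F) = 1 := by
    rw [QuotientGroup.mk_mul, ← sq]
    exact orderOf_dvd_iff_pow_eq_one.mp hA.dvd
  obtain ⟨s, hs⟩ := mem_center_iff.mp (mk_eq_one.mp hsq)
  exact trace_eq_zero_of_sq_scalar (not_scalar_of_orderOf hA) (by simpa using hs)

/-- Commuting matrices representing involutions of `PGL₂(F)` represent the same involution. -/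
lemma mk_eq_mk_of_commute (h2 : (2 : F) ≠ 0) {A B : GL (Fin 2) F}
    (hA : orderOf (A : PGL2 F) = 2) (hB : orderOf (B : PGL2 F) = 2) (h : A * B = B * A) :
    (A : PGL2 F) = (B : PGL2 F) := by
  obtain ⟨x, y, hxy⟩ := exists_eq_smul_one_add_smul (not_scalar_of_orderOf hA)
    (by simpa using congrArg Units.val h)
  have hx : x = 0 := by
    have := congrArg Matrix.trace hxy
    rw [trace_eq_zero_of_orderOf hB, Matrix.trace_add, Matrix.trace_smul, Matrix.trace_smul,
      trace_eq_zero_of_orderOf hA, Matrix.trace_one] at this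
    simpa [h2] using this
  rw [hx, zero_smul, zero_add] at hxy
  refine QuotientGroup.eq.mpr (mem_center_iff.mpr ⟨y, ?_⟩)
  rw [Units.val_mul, hxy, mul_smul_comm, Units.inv_mul]

/-- Only scalars commute with both members of an anticommuting pair in `GL₂(F)`. -/
lemma mem_center_of_commute_of_anticommute (h2 : (2 : F) ≠ 0) {A B D : GL (Fin 2) F}
    (hAB : A * B = -(B * A)) (hA : A * D = D * A) (hB : B * D = D * B) :
    D ∈ Subgroup.center (GL (Fin 2) F) := by
  have hAB' : (A : Matrix (Fin 2) (Fin 2) F) * B = -(B * A) := by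
    simpa using congrArg Units.val hAB
  have hBA (y : F) (hy : (B * (y • A) : Matrix (Fin 2) (Fin 2) F) = (y • A) * B) : y = 0 := by
    rw [smul_mul_assoc, hAB', mul_smul_comm, smul_neg, eq_neg_iff_add_eq_zero, ← two_smul F,
      smul_smul, ← Units.val_mul] at hy
    simpa [h2] using hy
  have hns (r : F) : (A : Matrix (Fin 2) (Fin 2) F) ≠ r • 1 := fun hr =>
    one_ne_zero (hBA 1 (by rw [hr]; simp))
  obtain ⟨x, y, hxy⟩ := exists_eq_smul_one_add_smul hns (by simpa using congrArg Units.val hA)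
  have hB' : (B : Matrix (Fin 2) (Fin 2) F) * D = D * B := by
    simpa using congrArg Units.val hB
  have hy : y = 0 := hBA y <| by
    rw [hxy, mul_add, add_mul] at hB'
    simpa using hB'
  exact mem_center_iff.mpr ⟨x, by rw [hxy, hy, zero_smul, add_zero]⟩

/-- Over a field of characteristic not two, the subgroup of `PGL₂(F)` generated by two distinct
commuting involutions is self-centralizing. -/
theorem centralizer_closure_pair (h2 : (2 : F) ≠ 0) {i j : PGL2 F}
    (hi : orderOf i = 2) (hj : orderOf j = 2) (hij : i ≠ j) (hcomm : i * j = j * i) :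
    Subgroup.centralizer (Subgroup.closure {i, j} : Set (PGL2 F)) = Subgroup.closure {i, j} := by
  rw [Subgroup.centralizer_closure]
  apply le_antisymm
  · intro g hg
    have hgi : i * g = g * i := hg i (by simp)
    have hgj : j * g = g * j := hg j (by simp)
    have hiV : i ∈ Subgroup.closure {i, j} := Subgroup.subset_closure (by simp)
    have hjV : j ∈ Subgroup.closure {i, j} := Subgroup.subset_closure (by simp)
    induction i using QuotientGroup.induction_on with | H A => ?_
    induction j using QuotientGroup.induction_on with | H B => ?_
    induction g using QuotientGroup.induction_on with | H C => ?_
    have hAB : A * B = -(B * A) :=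
      (commute_or_anticommute hcomm).resolve_left fun h => hij (mk_eq_mk_of_commute h2 hi hj h)
    have key (P : GL (Fin 2) F) (hP : (P : PGL2 F) ∈ Subgroup.closure {(A : PGL2 F), (B : PGL2 F)})
        (hA : A * (C * P) = C * P * A) (hB : B * (C * P) = C * P * B) :
        (C : PGL2 F) ∈ Subgroup.closure {(A : PGL2 F), (B : PGL2 F)} := by
      have h1 := mk_eq_one.mpr (mem_center_of_commute_of_anticommute h2 hAB hA hB)
      rw [QuotientGroup.mk_mul] at h1
      rw [eq_inv_of_mul_eq_one_left h1]
      exact inv_mem hP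
    have hBA : B * A = -(A * B) := by rw [hAB, neg_neg]
    rcases commute_or_anticommute hgi with hA | hA <;>
      rcases commute_or_anticommute hgj with hB | hB
    · exact key 1 (one_mem _) (by simpa using hA) (by simpa using hB)
    · refine key A hiV (by rw [← mul_assoc, hA]) ?_
      rw [← mul_assoc, hB, mul_assoc C A B, hAB, neg_mul, mul_neg, mul_assoc]
    · refine key B hjV ?_ (by rw [← mul_assoc, hB])
      rw [← mul_assoc, hA, mul_assoc C B A, hBA, neg_mul, mul_neg, mul_assoc]
    · refine key (A * B) (mul_mem hiV hjV) ?_ ?_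
      · rw [← mul_assoc, hA, mul_assoc C (A * B) A, mul_assoc A B A, hBA, neg_mul, mul_neg,
          mul_neg, mul_assoc]
      · rw [← mul_assoc, hB, mul_assoc C (A * B) B, neg_mul, mul_assoc, ← mul_assoc B A B, hBA,
          neg_mul, mul_neg, neg_neg]
  · rw [Subgroup.closure_le]
    rintro x (rfl | rfl) y (rfl | rfl)
    exacts [rfl, hcomm.symm, hcomm, rfl]

end Projective

end PGL2

/-- In `PGL₂(𝔽_q)` with `q` an odd prime power, a Klein four-subgroup
`V = ⟨i, j⟩` generated by two distinct commuting involutions is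
self-centralizing: `C_G(V) = V`. -/
theorem klein_four_self_centralizing_PGL2
    (p : ℕ) [Fact p.Prime] (hp : Odd p) (k : ℕ) (hk : 0 < k)
    (i j : PGL2 (GaloisField p k))
    (hi : orderOf i = 2) (hj : orderOf j = 2) (hij : i ≠ j)
    (hcomm : i * j = j * i)
    (V : Subgroup (PGL2 (GaloisField p k))) (hV : V = Subgroup.closure {i, j}) :
    Subgroup.centralizer (V : Set (PGL2 (GaloisField p k))) = V := by
  subst hV
  refine PGL2.centralizer_closure_pair ?_ hi hj hij hcomm
  intro h2
  have hdvd : p ∣ 2 := (CharP.cast_eq_zero_iff (GaloisField p k) p 2).mp (by exact_mod_cast h2)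
  rw [(Nat.prime_dvd_prime_iff_eq Fact.out Nat.prime_two).mp hdvd] at hp
  exact absurd hp (by decide)
end

section
/- Let q be an odd prime power and let G = PGL₂(𝔽_q). Let i, j ∈ G be two distinct commuting involutions and set k = i·j. Let g ∈ G, suppose h₁ = i·(g⁻¹·j·g) has odd order m₁, set n₁ = h₁^((m₁+1)/2) and s = (g·n₁⁻¹)⁻¹·k·(g·n₁⁻¹), suppose h₂ = j·s has odd order m₂, and set n₂ = h₂^((m₂+1)/2) and x = g·n₁⁻¹·n₂⁻¹. Then x has order exactly 3. -/
open Matrix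

/-- If `a`, `b` are involutions and `a * b` has odd order, then the square root of `a * b` among
its powers conjugates `b` to `a`. -/
theorem pow_conj_eq_of_odd_orderOf_mul {G : Type*} [Group G] {a b : G} (ha : a * a = 1)
    (hb : b * b = 1) (h : Odd (orderOf (a * b))) :
    (a * b) ^ ((orderOf (a * b) + 1) / 2) * b * ((a * b) ^ ((orderOf (a * b) + 1) / 2))⁻¹ = a := by
  obtain ⟨r, hr⟩ := h
  have hr' : (orderOf (a * b) + 1) / 2 = r + 1 := by omega
  have hsq : (a * b) ^ (r + 1) * (a * b) ^ (r + 1) = a * b := by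
    rw [← pow_add, show r + 1 + (r + 1) = orderOf (a * b) + 1 by omega, pow_succ,
      pow_orderOf_eq_one, one_mul]
  have hinv : b * (a * b) * b⁻¹ = (a * b)⁻¹ := by
    rw [_root_.mul_inv_rev, inv_eq_of_mul_eq_one_left ha, mul_assoc, mul_assoc, mul_inv_cancel, mul_one,
      inv_eq_of_mul_eq_one_left hb]
  have hconj : b * (a * b) ^ (r + 1) * b⁻¹ = ((a * b) ^ (r + 1))⁻¹ := by
    rw [← conj_pow, hinv, inv_pow]
  have hcomm : b * ((a * b) ^ (r + 1))⁻¹ = (a * b) ^ (r + 1) * b := by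
    rw [← hconj, ← mul_assoc, ← mul_assoc, hb, one_mul, inv_eq_of_mul_eq_one_left hb]
  rw [hr', mul_assoc, hcomm, ← mul_assoc, hsq, mul_assoc, hb, mul_one]

/-- An element permuting the involutions of a self-centralizing Klein four-subgroup cyclically
has order three. -/
theorem orderOf_eq_three_of_semiconjBy_cycle {G : Type*} [Group G] {i j x : G} (hi : i ≠ 1)
    (hj : j ≠ 1) (hij : i ≠ j)
    (hcent : ∀ z, Commute z i → Commute z j → z = 1 ∨ z = i ∨ z = j ∨ z = i * j)
    (hxi : SemiconjBy x i j) (hxj : SemiconjBy x j (i * j)) (hxk : SemiconjBy x (i * j) i) :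
    orderOf x = 3 := by
  have hx1 : x ≠ 1 := by
    rintro rfl
    exact hij (by simpa using hxi.eq)
  have hci : Commute (x ^ 3) i := by
    rw [pow_succ, sq]
    exact (hxk.mul_left hxj).mul_left hxi
  have hcj : Commute (x ^ 3) j := by
    rw [pow_succ, sq]
    exact (hxi.mul_left hxk).mul_left hxj
  have hcx : Commute x (x ^ 3) := (Commute.refl x).pow_right 3
  refine orderOf_eq_prime ?_ hx1
  rcases hcent _ hci hcj with h | h | h | h
  · exact h
  · rw [h] at hcx
    exact absurd (mul_right_cancel (hcx.eq.symm.trans hxi.eq)) hij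
  · rw [h] at hcx
    exact absurd (by simpa using mul_right_cancel (hcx.eq.symm.trans hxj.eq)) hi
  · rw [h] at hcx
    exact absurd (by simpa using mul_right_cancel (hcx.eq.symm.trans hxk.eq)) hj

/-- An element anticommuting with both `b` and `c` commutes with `b * c`. -/
theorem commute_mul_of_anticommute {R : Type*} [Ring R] {a b c : R} (hb : b * a = -(a * b))
    (hc : c * a = -(a * c)) : Commute a (b * c) := by
  rw [commute_iff_eq, mul_assoc, hc, mul_neg, ← mul_assoc, ← mul_assoc, hb, neg_mul, neg_neg]

section Matrices

variable {F : Type*} [Field F]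

/-- The commutant of a non-scalar `2 × 2` matrix `A` is spanned by `1` and `A`. -/
theorem exists_eq_smul_one_add_smul_of_commute {A Z : Matrix (Fin 2) (Fin 2) F}
    (hA : ∀ c : F, A ≠ c • 1) (h : A * Z = Z * A) : ∃ α β : F, Z = α • 1 + β • A := by
  have h00 := congrFun₂ h 0 0
  have h01 := congrFun₂ h 0 1
  have h10 := congrFun₂ h 1 0
  simp only [Matrix.mul_apply, Fin.sum_univ_two] at h00 h01 h10
  by_cases hb : A 0 1 = 0
  · by_cases hc : A 1 0 = 0
    · have hd : A 0 0 - A 1 1 ≠ 0 := by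
        intro hd
        refine hA (A 0 0) ?_
        ext a b
        fin_cases a <;> fin_cases b <;> simp [hb, hc]
        linear_combination -hd
      have hZ01 : Z 0 1 = 0 := by
        refine (mul_eq_zero.1 (?_ : (A 0 0 - A 1 1) * Z 0 1 = 0)).resolve_left hd
        linear_combination h01 + (Z 0 0 - Z 1 1) * hb
      have hZ10 : Z 1 0 = 0 := by
        refine (mul_eq_zero.1 (?_ : (A 0 0 - A 1 1) * Z 1 0 = 0)).resolve_left hd
        linear_combination -h10 + (Z 0 0 - Z 1 1) * hc
      refine ⟨Z 0 0 - (Z 0 0 - Z 1 1) / (A 0 0 - A 1 1) * A 0 0,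
        (Z 0 0 - Z 1 1) / (A 0 0 - A 1 1), ?_⟩
      ext a b
      fin_cases a <;> fin_cases b <;> simp [hb, hc, hZ01, hZ10]
      field_simp
      ring
    · refine ⟨Z 0 0 - Z 1 0 / A 1 0 * A 0 0, Z 1 0 / A 1 0, ?_⟩
      ext a b
      fin_cases a <;> fin_cases b <;> simp <;> field_simp
      · linear_combination -h00
      · linear_combination -h10
  · refine ⟨Z 0 0 - Z 0 1 / A 0 1 * A 0 0, Z 0 1 / A 0 1, ?_⟩
    ext a b
    fin_cases a <;> fin_cases b <;> simp <;> field_simp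
    · linear_combination h00
    · linear_combination h01

/-- A non-scalar `2 × 2` matrix whose square is scalar has trace zero. -/
theorem trace_eq_zero_of_mul_self_eq_smul_one {A : Matrix (Fin 2) (Fin 2) F}
    (hA : ∀ c : F, A ≠ c • 1) {a : F} (h : A * A = a • 1) : A.trace = 0 := by
  by_contra ht
  refine hA ((a + A.det) / A.trace) ?_
  have hCH : A.trace • A = (a + A.det) • (1 : Matrix (Fin 2) (Fin 2) F) := by
    rw [add_smul, ← h]
    ext a b
    fin_cases a <;> fin_cases b <;>
      simp [Matrix.trace_fin_two, Matrix.det_fin_two, Matrix.mul_apply, Fin.sum_univ_two] <;> ring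
  rw [div_eq_inv_mul, mul_smul, ← hCH, smul_smul, inv_mul_cancel₀ ht, one_smul]

/-- Two elements of `GL₂` agree in `PGL₂` iff they are proportional. -/
theorem PGL2.mk_eq_mk_iff {u v : GL (Fin 2) F} :
    (u : PGL2 F) = (v : PGL2 F) ↔
      ∃ c : F, (v : Matrix (Fin 2) (Fin 2) F) = c • (u : Matrix (Fin 2) (Fin 2) F) := by
  rw [QuotientGroup.eq, GeneralLinearGroup.mem_center_iff_val_mem_range_scalar]
  constructor
  · rintro ⟨c, hc⟩
    refine ⟨c, ?_⟩
    calc (v : Matrix (Fin 2) (Fin 2) F) = u * (u⁻¹ * v : GL (Fin 2) F) := by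
          rw [← Units.val_mul, mul_inv_cancel_left]
      _ = c • (u : Matrix (Fin 2) (Fin 2) F) := by
          rw [← hc, scalar_apply, ← smul_one_eq_diagonal, mul_smul_comm, mul_one]
  · rintro ⟨c, hc⟩
    refine ⟨c, ?_⟩
    rw [Units.val_mul, hc, mul_smul_comm, Units.inv_mul, scalar_apply, smul_one_eq_diagonal]

/-- Lifts of commuting elements of `PGL₂` either commute or anticommute. -/
theorem PGL2.mul_eq_or_mul_eq_neg {u v : GL (Fin 2) F}
    (h : (u : PGL2 F) * (v : PGL2 F) = (v : PGL2 F) * (u : PGL2 F)) :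
    (u : Matrix (Fin 2) (Fin 2) F) * v = v * u ∨
      (u : Matrix (Fin 2) (Fin 2) F) * v = -(v * u : Matrix (Fin 2) (Fin 2) F) := by
  rw [← QuotientGroup.mk_mul, ← QuotientGroup.mk_mul, eq_comm, PGL2.mk_eq_mk_iff] at h
  obtain ⟨c, hc⟩ := h
  rw [Units.val_mul, Units.val_mul] at hc
  have hu : (u : Matrix (Fin 2) (Fin 2) F).det ≠ 0 := u.det_ne_zero
  have hv : (v : Matrix (Fin 2) (Fin 2) F).det ≠ 0 := v.det_ne_zero
  have hdet := congrArg Matrix.det hc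
  rw [Matrix.det_smul, Matrix.det_mul, Matrix.det_mul, Fintype.card_fin] at hdet
  have hc2 : c ^ 2 = 1 := by
    refine mul_right_cancel₀ (mul_ne_zero hu hv) ?_
    linear_combination -hdet
  rcases sq_eq_one_iff.1 hc2 with rfl | rfl
  · exact .inl (by simpa using hc)
  · exact .inr (by simpa using hc)

/-- Klein four-subgroups of `PGL₂(F)` are self-centralizing in odd characteristic. -/
theorem PGL2.eq_of_commute_of_commute (h2 : (2 : F) ≠ 0) {i j z : PGL2 F} (hi : i ≠ 1) (hj : j ≠ 1)
    (hij : i ≠ j) (hi2 : i * i = 1) (hj2 : j * j = 1) (hcomm : i * j = j * i)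
    (hzi : Commute z i) (hzj : Commute z j) : z = 1 ∨ z = i ∨ z = j ∨ z = i * j := by
  obtain ⟨u, rfl⟩ := QuotientGroup.mk_surjective i
  obtain ⟨v, rfl⟩ := QuotientGroup.mk_surjective j
  have nonscalar {w : GL (Fin 2) F} (hw : (w : PGL2 F) ≠ 1) (c : F) :
      (w : Matrix (Fin 2) (Fin 2) F) ≠ c • 1 := fun h ↦
    hw (PGL2.mk_eq_mk_iff.2 ⟨c, by simpa using h⟩ : ((1 : GL (Fin 2) F) : PGL2 F) = w).symm
  have trace_zero {w : GL (Fin 2) F} (hw : (w : PGL2 F) ≠ 1) (hw2 : (w : PGL2 F) * w = 1) :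
      (w : Matrix (Fin 2) (Fin 2) F).trace = 0 := by
    rw [← QuotientGroup.mk_mul, ← QuotientGroup.mk_one, eq_comm, PGL2.mk_eq_mk_iff] at hw2
    obtain ⟨c, hc⟩ := hw2
    exact trace_eq_zero_of_mul_self_eq_smul_one (nonscalar hw) (by simpa using hc)
  have anti : (u : Matrix (Fin 2) (Fin 2) F) * v = -(v * u : Matrix (Fin 2) (Fin 2) F) := by
    refine (PGL2.mul_eq_or_mul_eq_neg hcomm).resolve_left fun h ↦ ?_
    obtain ⟨α, β, hv⟩ := exists_eq_smul_one_add_smul_of_commute (nonscalar hi) h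
    have ht := congrArg Matrix.trace hv
    rw [Matrix.trace_add, Matrix.trace_smul, Matrix.trace_smul, trace_zero hi hi2,
      trace_zero hj hj2, Matrix.trace_one, Fintype.card_fin] at ht
    have hα : α = 0 := by simpa [h2] using ht
    exact hij (PGL2.mk_eq_mk_iff.2 ⟨β, by simpa [hα] using hv⟩)
  have key {w : GL (Fin 2) F} (hwu : (u : Matrix (Fin 2) (Fin 2) F) * w = w * u)
      (hwv : (v : Matrix (Fin 2) (Fin 2) F) * w = w * v) : (w : PGL2 F) = 1 := by
    obtain ⟨α, β, hw⟩ := exists_eq_smul_one_add_smul_of_commute (nonscalar hi) hwu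
    have huv : (2 * β) • (v * u : GL (Fin 2) F).val = 0 := by
      rw [hw, mul_add, add_mul, mul_smul_comm, smul_mul_assoc, mul_one, one_mul, mul_smul_comm,
        smul_mul_assoc, anti, smul_neg] at hwv
      rw [Units.val_mul, mul_smul, two_smul]
      exact eq_neg_iff_add_eq_zero.1 (add_left_cancel hwv)
    have hβ : β = 0 := by simpa [h2] using huv
    refine (PGL2.mk_eq_mk_iff.2 ⟨α, ?_⟩ : ((1 : GL (Fin 2) F) : PGL2 F) = w).symm
    simpa [hβ] using hw
  obtain ⟨w, rfl⟩ := QuotientGroup.mk_surjective z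
  rcases PGL2.mul_eq_or_mul_eq_neg hzi with hwu | hwu <;>
    rcases PGL2.mul_eq_or_mul_eq_neg hzj with hwv | hwv
  · exact .inl (key hwu.symm hwv.symm)
  · have h : (w * u : GL (Fin 2) F) = (1 : PGL2 F) :=
      key (Commute.mul_right hwu.symm (Commute.refl _)) (commute_mul_of_anticommute hwv anti)
    rw [QuotientGroup.mk_mul] at h
    exact .inr (.inl ((mul_eq_one_iff_eq_inv.1 h).trans (inv_eq_of_mul_eq_one_left hi2)))
  · have h : (w * v : GL (Fin 2) F) = (1 : PGL2 F) :=
      key (commute_mul_of_anticommute hwu (by rw [anti, neg_neg]))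
        (Commute.mul_right hwv.symm (Commute.refl _))
    rw [QuotientGroup.mk_mul] at h
    exact .inr (.inr (.inl ((mul_eq_one_iff_eq_inv.1 h).trans (inv_eq_of_mul_eq_one_left hj2))))
  · have h : (w * (v * u) : GL (Fin 2) F) = (1 : PGL2 F) := by
      refine key (commute_mul_of_anticommute hwu ?_) (commute_mul_of_anticommute hwv ?_)
      · rw [Units.val_mul, ← mul_assoc, anti, neg_mul, neg_neg]
      · rw [Units.val_mul, mul_assoc, anti, mul_neg]
    rw [QuotientGroup.mk_mul, QuotientGroup.mk_mul] at h
    refine .inr (.inr (.inr ((mul_eq_one_iff_eq_inv.1 h).trans ?_)))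
    rw [_root_.mul_inv_rev, inv_eq_of_mul_eq_one_left hi2, inv_eq_of_mul_eq_one_left hj2]

end Matrices

/-- The order-3 conclusion of Lemma 2.2 of the paper: in `G = PGL₂(𝔽_q)`, `q` an
odd prime power, the element `x = g * n₁⁻¹ * n₂⁻¹` constructed from two distinct
commuting involutions `i`, `j` (with `k = i * j`) and an arbitrary `g` has order
exactly `3`. -/
theorem elt_of_order_three_PGL2
    (p : ℕ) [Fact p.Prime] (hp : Odd p) (κ : ℕ) (hκ : 0 < κ)
    (i j k : PGL2 (GaloisField p κ))
    (hi : orderOf i = 2) (hj : orderOf j = 2) (hij : i ≠ j)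
    (hcomm : i * j = j * i) (hk : k = i * j)
    (g : PGL2 (GaloisField p κ))
    (h₁ : PGL2 (GaloisField p κ)) (hh₁ : h₁ = i * (g⁻¹ * j * g))
    (m₁ : ℕ) (hm₁ : m₁ = orderOf h₁) (hm₁odd : Odd m₁)
    (n₁ : PGL2 (GaloisField p κ)) (hn₁ : n₁ = h₁ ^ ((m₁ + 1) / 2))
    (s : PGL2 (GaloisField p κ)) (hs : s = (g * n₁⁻¹)⁻¹ * k * (g * n₁⁻¹))
    (h₂ : PGL2 (GaloisField p κ)) (hh₂ : h₂ = j * s)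
    (m₂ : ℕ) (hm₂ : m₂ = orderOf h₂) (hm₂odd : Odd m₂)
    (n₂ : PGL2 (GaloisField p κ)) (hn₂ : n₂ = h₂ ^ ((m₂ + 1) / 2))
    (x : PGL2 (GaloisField p κ)) (hx : x = g * n₁⁻¹ * n₂⁻¹) :
    orderOf x = 3 := by
  have two_ne_zero' : (2 : GaloisField p κ) ≠ 0 := by
    refine Ring.two_ne_zero ?_
    rw [ringChar.eq (GaloisField p κ) p]
    rintro rfl
    exact absurd hp (by decide)
  have ne_one {a : PGL2 (GaloisField p κ)} (ha : orderOf a = 2) : a ≠ 1 := by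
    rintro rfl
    simp at ha
  have mul_self {a : PGL2 (GaloisField p κ)} (ha : orderOf a = 2) : a * a = 1 := by
    simpa only [ha, sq] using pow_orderOf_eq_one a
  have hi2 := mul_self hi
  have hj2 := mul_self hj
  have hk2 : k * k = 1 := by
    rw [hk, Commute.mul_mul_mul_comm hcomm.symm, hi2, hj2, one_mul]
  have mul_self_conj {a y : PGL2 (GaloisField p κ)} (ha : a * a = 1) :
      (y⁻¹ * a * y) * (y⁻¹ * a * y) = 1 := by
    rw [show (y⁻¹ * a * y) * (y⁻¹ * a * y) = y⁻¹ * (a * a) * y by group, ha]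
    group
  subst hm₁ hm₂ hh₁
  have hn₁i : n₁ * (g⁻¹ * j * g) * n₁⁻¹ = i :=
    hn₁ ▸ pow_conj_eq_of_odd_orderOf_mul hi2 (mul_self_conj hj2) hm₁odd
  have hyj : j * (g * n₁⁻¹) = (g * n₁⁻¹) * i := by
    rw [← hn₁i]
    group
  generalize g * n₁⁻¹ = y at *
  have hs2 : s * s = 1 := hs ▸ mul_self_conj hk2
  subst hh₂
  have hn₂j : n₂ * s * n₂⁻¹ = j := hn₂ ▸ pow_conj_eq_of_odd_orderOf_mul hj2 hs2 hm₂odd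
  have hjk : Commute j k := by
    rw [hk]
    exact (Commute.symm hcomm).mul_right (Commute.refl j)
  have hiy : i = y⁻¹ * j * y := by rw [mul_assoc, hyj, inv_mul_cancel_left]
  have his : Commute i s := by
    rw [hiy, hs]
    simpa using hjk.conj y⁻¹
  have hin₂ : Commute i n₂ := hn₂ ▸ (Commute.mul_right hcomm his).pow_right _
  have hxj : j * x = x * i := by
    rw [hx, ← mul_assoc, hyj, mul_assoc, hin₂.inv_right.eq, mul_assoc]
  have hxk : k * x = x * j := by
    rw [hx, ← hn₂j, hs]
    group
  have hxi : i * x = x * (i * j) := by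
    have : i = j * k := by rw [hk, hcomm, ← mul_assoc, hj2, one_mul]
    rw [← mul_assoc, ← hxj, mul_assoc, ← hxk, ← mul_assoc, ← this]
  exact orderOf_eq_three_of_semiconjBy_cycle (ne_one hi) (ne_one hj) hij
    (fun z ↦ PGL2.eq_of_commute_of_commute two_ne_zero' (ne_one hi) (ne_one hj) hij hi2 hj2 hcomm)
    hxj.symm (hk ▸ hxk.symm) hxi.symm
end

section
/- Let G be a group, let i, j ∈ G be two distinct commuting involutions (i² = j² = 1, i ≠ 1, j ≠ 1, i ≠ j, ij = ji), set k = i·j, and let x ∈ G satisfy x³ = 1, x⁻¹·i·x = k and x⁻¹·j·x = i. Then the subgroup of G generated by {i, j, x} is isomorphic to the alternating group on 4 letters. -/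
/-- Two distinct commuting involutions `i`, `j`, together with an element `x` with `x ^ 3 = 1`
whose conjugation permutes `i`, `j`, `i * j` cyclically. -/
structure IsTetrahedralTriple {G : Type*} [Group G] (i j x : G) : Prop where
  left_mul_self : i * i = 1
  right_mul_self : j * j = 1
  left_ne_one : i ≠ 1
  right_ne_one : j ≠ 1
  left_ne_right : i ≠ j
  right_mul_left : j * i = i * j
  rot_cube : x * (x * x) = 1
  rot_mul_left : x * i = j * x
  rot_mul_right : x * j = i * (j * x)

/-- The multiplication of `Alt₄` on normal forms: `(p, q, r)` stands for `i ^ p * j ^ q * x ^ r`. -/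
def tetrahedralMul (u v : ZMod 2 × ZMod 2 × ZMod 3) : ZMod 2 × ZMod 2 × ZMod 3 :=
  let w : ZMod 2 × ZMod 2 :=
    (fun t : ZMod 2 × ZMod 2 => (t.2, t.1 + t.2))^[u.2.2.val] (v.1, v.2.1)
  (u.1 + w.1, u.2.1 + w.2, u.2.2 + v.2.2)

/-- Evaluation of the normal form `(p, q, r)` as `i ^ p * j ^ q * x ^ r`. -/
def tetrahedralWord {G : Type*} [Group G] (i j x : G) (u : ZMod 2 × ZMod 2 × ZMod 3) : G :=
  i ^ u.1.val * j ^ u.2.1.val * x ^ u.2.2.val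

theorem tetrahedralMul_cancel (v : ZMod 2 × ZMod 2 × ZMod 3) :
    ∃ w, tetrahedralMul v w = 0 ∧ ∀ u, tetrahedralMul u w = 0 → u = v := by
  revert v
  decide

namespace IsTetrahedralTriple

variable {G : Type*} [Group G] {i j x : G}

theorem word_mul (h : IsTetrahedralTriple i j x) (u v : ZMod 2 × ZMod 2 × ZMod 3) :
    tetrahedralWord i j x (tetrahedralMul u v) =
      tetrahedralWord i j x u * tetrahedralWord i j x v := by
  obtain ⟨hii, hjj, -, -, -, hji, hxxx, hxi, hxj⟩ := h
  have hii' (t : G) : i * (i * t) = t := by rw [← mul_assoc, hii, one_mul]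
  have hjj' (t : G) : j * (j * t) = t := by rw [← mul_assoc, hjj, one_mul]
  have hji' (t : G) : j * (i * t) = i * (j * t) := by rw [← mul_assoc, hji, mul_assoc]
  have hxi' (t : G) : x * (i * t) = j * (x * t) := by rw [← mul_assoc, hxi, mul_assoc]
  have hxj' (t : G) : x * (j * t) = i * (j * (x * t)) := by
    rw [← mul_assoc, hxj, mul_assoc, mul_assoc]
  have val_two : ∀ p : ZMod 2, p = 0 ∨ p = 1 := by decide
  have val_three : ∀ r : ZMod 3, r = 0 ∨ r = 1 ∨ r = 2 := by decide
  have h2 : (1 + 1 : ZMod 2) = 0 := rfl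
  have h12 : (1 + 2 : ZMod 3) = 0 := rfl
  have h21 : (2 + 1 : ZMod 3) = 0 := rfl
  have h22 : (2 + 2 : ZMod 3) = 1 := rfl
  have h11 : (1 + 1 : ZMod 3) = 2 := rfl
  have v1 : (1 : ZMod 2).val = 1 := rfl
  have v1' : (1 : ZMod 3).val = 1 := rfl
  have v2 : (2 : ZMod 3).val = 2 := rfl
  obtain ⟨p, q, r⟩ := u
  obtain ⟨p', q', r'⟩ := v
  rcases val_two p with rfl | rfl <;> rcases val_two q with rfl | rfl <;>
  rcases val_three r with rfl | rfl | rfl <;> rcases val_two p' with rfl | rfl <;>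
  rcases val_two q' with rfl | rfl <;> rcases val_three r' with rfl | rfl | rfl <;>
  simp [tetrahedralWord, tetrahedralMul, h2, h12, h21, h22, h11, v1, v1', v2, pow_two, mul_assoc,
    hii, hjj, hji, hxi, hxj, hxxx, hii', hjj', hji', hxi', hxj']

theorem eq_zero_of_word_eq_one (h : IsTetrahedralTriple i j x) {u : ZMod 2 × ZMod 2 × ZMod 3}
    (hu : tetrahedralWord i j x u = 1) : u = 0 := by
  have hi : i⁻¹ = i := inv_eq_of_mul_eq_one_left h.left_mul_self
  have val_two : ∀ p : ZMod 2, p = 0 ∨ p = 1 := by decide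
  have val_three : ∀ r : ZMod 3, r = 0 ∨ r.val * r.val = 1 ∨ r.val * r.val = 4 := by decide
  obtain ⟨p, q, r⟩ := u
  have hcomm : Commute (x ^ (r.val * r.val)) i := by
    have hV : Commute (i ^ p.val * j ^ q.val) i :=
      ((Commute.refl i).pow_left _).mul_left (Commute.pow_left h.right_mul_left _)
    rw [pow_mul]
    refine Commute.pow_left ?_ _
    rw [show x ^ r.val = (i ^ p.val * j ^ q.val)⁻¹ from eq_inv_of_mul_eq_one_right hu]
    exact hV.inv_left
  have hx : ¬ Commute x i := fun hx =>
    h.left_ne_right (mul_right_cancel (hx.eq.symm.trans h.rot_mul_left))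
  have hr : r = 0 := by
    rcases val_three r with hr | hr | hr
    · exact hr
    · rw [hr, pow_one] at hcomm
      exact absurd hcomm hx
    · have hx4 : x ^ 4 = x := by
        rw [pow_succ, pow_succ', pow_two, h.rot_cube, one_mul]
      rw [hr, hx4] at hcomm
      exact absurd hcomm hx
  subst hr
  rcases val_two p with rfl | rfl <;> rcases val_two q with rfl | rfl
  · rfl
  · exact absurd (by simpa [tetrahedralWord, ZMod.val_one] using hu) h.right_ne_one
  · exact absurd (by simpa [tetrahedralWord, ZMod.val_one] using hu) h.left_ne_one
  · have hij : i * j = 1 := by simpa [tetrahedralWord, ZMod.val_one] using hu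
    exact absurd (hi.symm.trans (inv_eq_of_mul_eq_one_right hij)) h.left_ne_right

theorem word_injective (h : IsTetrahedralTriple i j x) :
    Function.Injective (tetrahedralWord i j x) := by
  intro u v huv
  obtain ⟨w, hvw, hw⟩ := tetrahedralMul_cancel v
  refine hw u (h.eq_zero_of_word_eq_one ?_)
  rw [h.word_mul, huv, ← h.word_mul, hvw]
  simp [tetrahedralWord]

end IsTetrahedralTriple

theorem isTetrahedralTriple_alternatingGroup :
    IsTetrahedralTriple (G := alternatingGroup (Fin 4))
      ⟨Equiv.swap 0 1 * Equiv.swap 2 3, by simp [Equiv.Perm.mem_alternatingGroup]⟩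
      ⟨Equiv.swap 0 2 * Equiv.swap 1 3, by simp [Equiv.Perm.mem_alternatingGroup]⟩
      ⟨Equiv.swap 1 2 * Equiv.swap 2 3, by simp [Equiv.Perm.mem_alternatingGroup]⟩ := by
  constructor <;> decide

namespace IsTetrahedralTriple

variable {G : Type*} [Group G] {i j x : G}

theorem nonempty_closure_mulEquiv (h : IsTetrahedralTriple i j x) :
    Nonempty (Subgroup.closure {i, j, x} ≃* alternatingGroup (Fin 4)) := by
  have hbij := (Fintype.bijective_iff_injective_and_card _).2
    ⟨isTetrahedralTriple_alternatingGroup.word_injective, by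
      rw [card_alternatingGroup]; rfl⟩
  let e := Equiv.ofBijective _ hbij
  let f : alternatingGroup (Fin 4) →* G := MonoidHom.mk' (fun g => tetrahedralWord i j x (e.symm g))
    fun g g' => by
      rw [← h.word_mul]
      congr 1
      rw [Equiv.symm_apply_eq]
      refine Eq.trans ?_ (isTetrahedralTriple_alternatingGroup.word_mul _ _).symm
      exact congrArg₂ (· * ·) (e.apply_symm_apply g).symm (e.apply_symm_apply g').symm
  have hf : Function.Injective f := h.word_injective.comp e.symm.injective
  have hrange : f.range = Subgroup.closure {i, j, x} := by
    have hword (u) : tetrahedralWord i j x u ∈ f.range :=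
      ⟨e u, congrArg (tetrahedralWord i j x) (e.symm_apply_apply u)⟩
    apply le_antisymm
    · rintro _ ⟨g, rfl⟩
      have hmem {y : G} (hy : y ∈ ({i, j, x} : Set G)) (n : ℕ) :
          y ^ n ∈ Subgroup.closure {i, j, x} :=
        pow_mem (Subgroup.subset_closure hy) n
      exact mul_mem (mul_mem (hmem (by simp) _) (hmem (by simp) _)) (hmem (by simp) _)
    · rw [Subgroup.closure_le]
      rintro y (rfl | rfl | rfl)
      · simpa [tetrahedralWord, ZMod.val_one] using hword (1, 0, 0)
      · simpa [tetrahedralWord, ZMod.val_one] using hword (0, 1, 0)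
      · simpa [tetrahedralWord, ZMod.val_one] using hword (0, 0, 1)
  exact ⟨((MonoidHom.ofInjective hf).trans (MulEquiv.subgroupCongr hrange)).symm⟩

end IsTetrahedralTriple

/-- If `i`, `j` are distinct commuting involutions of a group `G`, `k = i * j`,
and `x` satisfies `x³ = 1`, `x⁻¹ * i * x = k` and `x⁻¹ * j * x = i`, then
`⟨i, j, x⟩ ≅ Alt₄`. -/
theorem closure_isomorphic_alt4 {G : Type*} [Group G] (i j k : G)
    (hi2 : i ^ 2 = 1) (hj2 : j ^ 2 = 1) (hi1 : i ≠ 1) (hj1 : j ≠ 1) (hij : i ≠ j)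
    (hcomm : i * j = j * i) (hk : k = i * j)
    (x : G) (hx3 : x ^ 3 = 1) (hxi : x⁻¹ * i * x = k) (hxj : x⁻¹ * j * x = i) :
    Nonempty ((Subgroup.closure {i, j, x} : Subgroup G) ≃* alternatingGroup (Fin 4)) := by
  have hx : x * i = j * x := by rw [← hxj]; group
  have hix : i * x = x * (i * j) := by rw [← hk, ← hxi]; group
  have hii : i * i = 1 := by rw [← pow_two, hi2]
  have hjj : j * j = 1 := by rw [← pow_two, hj2]
  refine IsTetrahedralTriple.nonempty_closure_mulEquiv
    ⟨hii, hjj, hi1, hj1, hij, hcomm.symm, by rw [← hx3, pow_succ', pow_two], hx, ?_⟩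
  calc x * j = x * (i * (i * j)) := by rw [← mul_assoc i, hii, one_mul]
    _ = j * (x * (i * j)) := by rw [← mul_assoc, hx, mul_assoc]
    _ = i * (j * x) := by rw [← hix, ← mul_assoc, ← hcomm, mul_assoc]
end

section
/- Let q be an odd prime power and let H = PSL₂(𝔽_q). Let a denote whichever of (q−1)/2 and (q+1)/2 is odd. Then the number of involutions in H, i.e. the number of elements g ∈ H with g² = 1 and g ≠ 1, equals a·q. -/
open Matrix

/-- `PSL₂(F)`: the quotient of `SL₂(F)` by its center. -/
abbrev PSL2 (F : Type*) [Field F] : Type _ :=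
  Matrix.SpecialLinearGroup (Fin 2) F ⧸
    Subgroup.center (Matrix.SpecialLinearGroup (Fin 2) F)

theorem SL2_mem_center_iff {F : Type*} [Field F] (A : Matrix.SpecialLinearGroup (Fin 2) F) :
    A ∈ Subgroup.center (Matrix.SpecialLinearGroup (Fin 2) F) ↔
      A 0 1 = 0 ∧ A 1 0 = 0 ∧ A 0 0 = A 1 1 := by
  rw [Matrix.SpecialLinearGroup.mem_center_iff]
  constructor
  · rintro ⟨r, -, hr⟩
    simp [← hr]
  · rintro ⟨h01, h10, h⟩
    have hdet := A.det_coe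
    rw [Matrix.det_fin_two, h01, ← h] at hdet
    refine ⟨A 0 0, by simpa [pow_two] using hdet, ?_⟩
    ext i j
    fin_cases i <;> fin_cases j <;> simp [h01, h10, h]

theorem PSL2_mk_isInvolution_iff {F : Type*} [Field F] (h2 : (2 : F) ≠ 0)
    (A : Matrix.SpecialLinearGroup (Fin 2) F) :
    ((A : PSL2 F) ^ 2 = 1 ∧ (A : PSL2 F) ≠ 1) ↔ A 0 0 + A 1 1 = 0 := by
  have hdet := A.det_coe
  rw [Matrix.det_fin_two] at hdet
  rw [← QuotientGroup.mk_pow, Ne, QuotientGroup.eq_one_iff, QuotientGroup.eq_one_iff,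
    SL2_mem_center_iff, SL2_mem_center_iff]
  simp only [pow_two, Matrix.SpecialLinearGroup.coe_mul, Matrix.mul_apply, Fin.sum_univ_two]
  constructor
  · rintro ⟨⟨h01, h10, h⟩, hA⟩
    by_contra ht
    refine hA ⟨?_, ?_, ?_⟩
    · exact (mul_eq_zero.mp (by linear_combination h01 : A 0 1 * (A 0 0 + A 1 1) = 0)).resolve_right
        ht
    · exact (mul_eq_zero.mp (by linear_combination h10 : A 1 0 * (A 0 0 + A 1 1) = 0)).resolve_right
        ht
    · exact sub_eq_zero.mp ((mul_eq_zero.mp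
        (by linear_combination h : (A 0 0 - A 1 1) * (A 0 0 + A 1 1) = 0)).resolve_right ht)
  · intro ht
    refine ⟨⟨by linear_combination A 0 1 * ht, by linear_combination A 1 0 * ht,
      by linear_combination (A 0 0 - A 1 1) * ht⟩, ?_⟩
    rintro ⟨h01, -, h⟩
    have h0 : A 0 0 = 0 :=
      (mul_eq_zero.mp (by linear_combination ht + h : 2 * A 0 0 = 0)).resolve_left h2
    simp [h0, h01] at hdet

theorem card_center_SL2 {F : Type*} [Field F] (h2 : (2 : F) ≠ 0) :
    Nat.card (Subgroup.center (Matrix.SpecialLinearGroup (Fin 2) F)) = 2 := by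
  have hprim : IsPrimitiveRoot (-1 : F) 2 :=
    IsPrimitiveRoot.neg_one (ringChar F) (fun h ↦ h2 (by
      have := ringChar.Nat.cast_ringChar (R := F)
      rwa [h] at this))
  rw [Nat.card_congr (Matrix.SpecialLinearGroup.center_equiv_rootsOfUnity
    (n := Fin 2) (R := F)).toEquiv]
  simpa using hprim.card_rootsOfUnity

/-- Trace-zero matrices in `SL₂(F)` as the points of a quadric, split according to whether
the upper right entry vanishes. -/
noncomputable def SL2TraceZeroEquiv (F : Type*) [Field F] [DecidableEq F] :
    {A : Matrix.SpecialLinearGroup (Fin 2) F // A 0 0 + A 1 1 = 0} ≃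
      (F × Fˣ) ⊕ ({x : F // x ^ 2 = -1} × F) where
  toFun A :=
    if h : A.1 0 1 = 0 then
      Sum.inr (⟨A.1 0 0, by
        have hdet := A.1.det_coe
        rw [Matrix.det_fin_two, h] at hdet
        linear_combination A.1 0 0 * A.2 - hdet⟩, A.1 1 0)
    else Sum.inl (A.1 0 0, Units.mk0 _ h)
  invFun
    | Sum.inl (x, y) => ⟨⟨!![x, y; -(x ^ 2 + 1) * (y⁻¹ : Fˣ), -x], by
        rw [Matrix.det_fin_two_of]
        linear_combination (x ^ 2 + 1) * y.mul_inv⟩, by simp⟩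
    | Sum.inr (x, z) => ⟨⟨!![x, 0; z, -x], by
        rw [Matrix.det_fin_two_of]
        linear_combination -x.2⟩, by simp⟩
  left_inv := by
    rintro ⟨A, hA⟩
    have hdet := A.det_coe
    rw [Matrix.det_fin_two] at hdet
    have h11 : -A 0 0 = A 1 1 := by linear_combination -hA
    by_cases h : A 0 1 = 0
    · ext i j
      fin_cases i <;> fin_cases j <;> simp [h, h11]
    · have h10 : -(A 0 0 ^ 2 + 1) * (A 0 1)⁻¹ = A 1 0 := by
        field_simp
        linear_combination hdet - A 0 0 * hA
      ext i j
      fin_cases i <;> fin_cases j <;> simp [h, h11]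
      linear_combination h10
  right_inv := by
    rintro (⟨x, y⟩ | ⟨⟨x, hx⟩, z⟩) <;> simp

theorem card_sq_eq_neg_one {F : Type*} [Field F] [Fintype F] [DecidableEq F]
    (hF : ringChar F ≠ 2) :
    (Nat.card {x : F // x ^ 2 = -1} : ℤ) = ZMod.χ₄ (Nat.card F) + 1 := by
  rw [Nat.card_eq_fintype_card (α := F), ← quadraticChar_neg_one hF, ← quadraticChar_card_sqrts hF]
  simp [Nat.card_eq_fintype_card, Fintype.card_subtype]

theorem two_mul_card_involutions_PSL2 {F : Type*} [Field F] [Finite F] (h2 : (2 : F) ≠ 0) :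
    2 * Nat.card {g : PSL2 F // g ^ 2 = 1 ∧ g ≠ 1} =
      Nat.card F * (Nat.card F - 1) + Nat.card {x : F // x ^ 2 = -1} * Nat.card F := by
  classical
  have e := QuotientGroup.preimageMkEquivSubgroupProdSet
    (Subgroup.center (Matrix.SpecialLinearGroup (Fin 2) F))
    {g : PSL2 F | g ^ 2 = 1 ∧ g ≠ 1}
  have hc := Nat.card_congr e
  rw [Nat.card_prod, card_center_SL2 h2] at hc
  refine hc.symm.trans ?_
  rw [← Nat.card_units, ← Nat.card_prod, ← Nat.card_prod, ← Nat.card_sum]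
  exact Nat.card_congr ((Equiv.subtypeEquivRight (PSL2_mk_isInvolution_iff h2)).trans
    (SL2TraceZeroEquiv F))

/-- In `H = PSL₂(𝔽_q)`, `q` an odd prime power, the number of involutions is
`a * q`, where `a` is whichever of `(q-1)/2` and `(q+1)/2` is odd. -/
theorem card_involutions_PSL2
    (p : ℕ) [Fact p.Prime] (hp : Odd p) (k : ℕ) (hk : 0 < k)
    (q : ℕ) (hq : q = p ^ k)
    (a : ℕ) (ha : (a = (q - 1) / 2 ∨ a = (q + 1) / 2) ∧ Odd a) :
    Nat.card {g : PSL2 (GaloisField p k) // g ^ 2 = 1 ∧ g ≠ 1} = a * q := by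
  classical
  obtain ⟨ha, hodd⟩ := ha
  have : Fintype (GaloisField p k) := Fintype.ofFinite _
  have hcard : Nat.card (GaloisField p k) = q := by rw [GaloisField.card p k hk.ne', hq]
  have hchar : ringChar (GaloisField p k) ≠ 2 := by
    rw [ringChar.eq (GaloisField p k) p]
    rintro rfl
    exact absurd hp (by decide)
  have hI := two_mul_card_involutions_PSL2 (F := GaloisField p k) (Ring.two_ne_zero hchar)
  have hS := card_sq_eq_neg_one hchar
  rw [hcard] at hI hS
  have hqodd : q % 4 = 1 ∨ q % 4 = 3 := by
    have := Nat.odd_iff.mp (hq ▸ hp.pow : Odd q)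
    omega
  rw [Nat.odd_iff] at hodd
  refine Nat.eq_of_mul_eq_mul_left two_pos (hI.trans ?_)
  rcases hqodd with h | h
  · rw [ZMod.χ₄_nat_one_mod_four h] at hS
    have hS' : Nat.card {x : GaloisField p k // x ^ 2 = -1} = 2 := by omega
    have hq' : q - 1 + 2 = 2 * a := by omega
    rw [hS', ← mul_assoc, ← hq']
    ring
  · rw [ZMod.χ₄_nat_three_mod_four h] at hS
    have hS' : Nat.card {x : GaloisField p k // x ^ 2 = -1} = 0 := by omega
    have hq' : q - 1 = 2 * a := by omega
    rw [hS', hq']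
    ring
end

section
/- Let q be an odd prime power and let H = PSL₂(𝔽_q). For every involution i ∈ H, the centralizer C_H(i) has cardinality q−1 if q ≡ 1 (mod 4) and cardinality q+1 if q ≡ 3 (mod 4); that is, |C_H(i)| = 2b where b is whichever of (q−1)/2 and (q+1)/2 is even. -/
open Matrix

section SumOfTwoSquares

/-- The affine conic `x ^ 2 + y ^ 2 = c`. -/
def TwoSquares (F : Type*) [Field F] (c : F) : Type _ :=
  {z : F × F // z.1 ^ 2 + z.2 ^ 2 = c}

variable {F : Type*} [Field F]

lemma TwoSquares.ext {c : F} {z w : TwoSquares F c} (h₁ : z.1.1 = w.1.1) (h₂ : z.1.2 = w.1.2) :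
    z = w :=
  Subtype.ext (Prod.ext h₁ h₂)

open Polynomial in
lemma exists_sq_add_sq_eq [Finite F] (hF : Nat.card F % 2 = 1) (c : F) :
    ∃ a b : F, a ^ 2 + b ^ 2 = c := by
  have := Fintype.ofFinite F
  obtain ⟨a, b, hab⟩ := FiniteField.exists_root_sum_quadratic (f := (X ^ 2 : F[X]))
    (g := X ^ 2 - C c) (degree_X_pow 2) (degree_X_pow_sub_C (by decide) _)
    (by rwa [← Nat.card_eq_fintype_card])
  refine ⟨a, b, ?_⟩
  simp only [eval_pow, eval_X, eval_sub, eval_C] at hab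
  linear_combination hab

lemma card_twoSquares_eq_card_one [Finite F] (hF : Nat.card F % 2 = 1) {c : F} (hc : c ≠ 0) :
    Nat.card (TwoSquares F c) = Nat.card (TwoSquares F 1) := by
  obtain ⟨u, v, huv⟩ := exists_sq_add_sq_eq hF c
  symm
  refine Nat.card_congr
    { toFun := fun z ↦ ⟨(u * z.1.1 - v * z.1.2, u * z.1.2 + v * z.1.1), ?_⟩
      invFun := fun z ↦ ⟨((u * z.1.1 + v * z.1.2) / c, (u * z.1.2 - v * z.1.1) / c), ?_⟩
      left_inv := ?_
      right_inv := ?_ }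
  · have := z.2
    linear_combination (u ^ 2 + v ^ 2) * this + huv
  · have := z.2
    field_simp
    linear_combination (u ^ 2 + v ^ 2) * this + c * huv
  · rintro ⟨⟨x, y⟩, h⟩
    apply TwoSquares.ext
    · simp only
      field_simp
      linear_combination x * huv
    · simp only
      field_simp
      linear_combination y * huv
  · rintro ⟨⟨x, y⟩, h⟩
    apply TwoSquares.ext
    · simp only
      field_simp
      linear_combination x * huv
    · simp only
      field_simp
      linear_combination y * huv

lemma card_twoSquares_one_of_isSquare (h2 : (2 : F) ≠ 0) (h : IsSquare (-1 : F)) :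
    Nat.card (TwoSquares F 1) = Nat.card F - 1 := by
  obtain ⟨e, he⟩ := h
  have he0 : e ≠ 0 := by
    rintro rfl
    simp at he
  rw [← Nat.card_units]
  refine Nat.card_congr
    { toFun := fun z ↦ ⟨z.1.1 + e * z.1.2, z.1.1 - e * z.1.2, ?_, ?_⟩
      invFun := fun u ↦ ⟨((u.1 + u.2) / 2, (u.1 - u.2) / (2 * e)), ?_⟩
      left_inv := ?_
      right_inv := ?_ }
  · linear_combination z.2 + z.1.2 ^ 2 * he
  · linear_combination z.2 + z.1.2 ^ 2 * he
  · have h₁ := u.3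
    field_simp
    linear_combination 4 * e ^ 2 * h₁ - (u.1 - u.2) ^ 2 * he
  · rintro ⟨⟨x, y⟩, h⟩
    apply TwoSquares.ext
    · simp only
      field_simp
      ring
    · simp only
      field_simp
      ring
  · intro u
    ext
    simp only
    field_simp
    ring

lemma card_twoSquares_one_of_not_isSquare [Finite F] (hF : Nat.card F % 2 = 1)
    (h : ¬ IsSquare (-1 : F)) :
    Nat.card (TwoSquares F 1) = Nat.card F + 1 := by
  classical
  have := Fintype.ofFinite F
  have (c : F) : Finite (TwoSquares F c) := Subtype.finite
  have h₀ : Nat.card (TwoSquares F 0) = 1 := by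
    rw [Nat.card_eq_one_iff_exists]
    refine ⟨⟨(0, 0), by simp⟩, fun ⟨⟨x, y⟩, hz⟩ ↦ ?_⟩
    have hy : y = 0 := by
      by_contra hy
      refine h ⟨x / y, ?_⟩
      simp only at hz
      field_simp
      linear_combination -hz
    subst hy
    have hx : x = 0 := by simpa using hz
    subst hx
    rfl
  have htot : Nat.card F * Nat.card F = ∑ c : F, Nat.card (TwoSquares F c) := by
    rw [← Nat.card_prod, ← Nat.card_sigma]
    exact Nat.card_congr (Equiv.sigmaFiberEquiv fun z : F × F ↦ z.1 ^ 2 + z.2 ^ 2).symm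
  rw [← Finset.add_sum_erase _ _ (Finset.mem_univ (0 : F)), h₀,
    Finset.sum_congr rfl fun c hc ↦ card_twoSquares_eq_card_one hF (Finset.ne_of_mem_erase hc),
    Finset.sum_const, Finset.card_erase_of_mem (Finset.mem_univ _), Finset.card_univ,
    ← Nat.card_eq_fintype_card] at htot
  have hq : 1 < Nat.card F := Finite.one_lt_card
  obtain ⟨m, hm⟩ : ∃ m, Nat.card F = m + 2 := ⟨Nat.card F - 2, by omega⟩
  rw [hm] at htot ⊢
  simp only [smul_eq_mul, Nat.add_succ_sub_one] at htot
  have : (m + 1) * Nat.card (TwoSquares F 1) = (m + 1) * (m + 2 + 1) := by linarith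
  exact Nat.eq_of_mul_eq_mul_left (by omega) this

end SumOfTwoSquares

namespace Subgroup

lemma card_centralizer_singleton_conj {G : Type*} [Group G] (g x : G) :
    Nat.card (centralizer {g * x * g⁻¹}) = Nat.card (centralizer {x}) := by
  symm
  refine Nat.card_congr ((MulAut.conj g).toEquiv.subtypeEquiv fun y ↦ ?_)
  simp only [mem_centralizer_singleton_iff, MulEquiv.toEquiv_eq_coe, MulEquiv.coe_toEquiv,
    MulAut.conj_apply]
  have h₁ : g * y * g⁻¹ * (g * x * g⁻¹) = g * (y * x) * g⁻¹ := by group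
  have h₂ : g * x * g⁻¹ * (g * y * g⁻¹) = g * (x * y) * g⁻¹ := by group
  rw [h₁, h₂, mul_left_inj, mul_right_inj]

end Subgroup

namespace Matrix.SpecialLinearGroup

variable {F : Type*} [Field F]

lemma mem_center_fin_two_iff {g : SpecialLinearGroup (Fin 2) F} :
    g ∈ Subgroup.center (SpecialLinearGroup (Fin 2) F) ↔ g = 1 ∨ g = -1 := by
  rw [mem_center_iff]
  constructor
  · rintro ⟨r, hr, h⟩
    rw [Fintype.card_fin, sq_eq_one_iff] at hr
    rcases hr with rfl | rfl
    · left
      apply Subtype.ext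
      simp [← h]
    · right
      apply Subtype.ext
      rw [← h, map_neg, map_one, coe_neg, coe_one]
  · rintro (rfl | rfl)
    · exact ⟨1, by simp⟩
    · exact ⟨-1, by simp, by rw [map_neg, map_one, coe_neg, coe_one]⟩

lemma one_ne_neg_one (h2 : (2 : F) ≠ 0) : (1 : SpecialLinearGroup (Fin 2) F) ≠ -1 := by
  intro h
  have h₀ := congrArg (fun g : SpecialLinearGroup (Fin 2) F ↦ g 0 0) h
  simp at h₀
  exact h2 (by linear_combination h₀)

lemma card_center_fin_two (h2 : (2 : F) ≠ 0) :
    Nat.card (Subgroup.center (SpecialLinearGroup (Fin 2) F)) = 2 := by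
  have : (Subgroup.center (SpecialLinearGroup (Fin 2) F) :
      Set (SpecialLinearGroup (Fin 2) F)) = {1, -1} := by
    ext g
    simp [mem_center_fin_two_iff]
  rw [← SetLike.coe_sort_coe, this, Nat.card_coe_set_eq, Set.ncard_pair (one_ne_neg_one h2)]

/-- The rotation by a right angle. -/
def rightAngle (F : Type*) [Field F] : SpecialLinearGroup (Fin 2) F :=
  ⟨!![0, -1; 1, 0], by simp⟩

lemma coe_rightAngle : (rightAngle F : Matrix (Fin 2) (Fin 2) F) = !![0, -1; 1, 0] := rfl

lemma mul_rightAngle_eq_iff {g : SpecialLinearGroup (Fin 2) F} :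
    g * rightAngle F = rightAngle F * g ↔ g 0 1 = -g 1 0 ∧ g 1 1 = g 0 0 := by
  rw [SpecialLinearGroup.ext_iff, coe_mul, coe_mul, coe_rightAngle]
  simp only [Fin.forall_fin_two, Matrix.mul_apply, Fin.sum_univ_two]
  simp
  grind

lemma mul_rightAngle_eq_neg_iff {g : SpecialLinearGroup (Fin 2) F} :
    g * rightAngle F = -(rightAngle F * g) ↔ g 0 1 = g 1 0 ∧ g 1 1 = -g 0 0 := by
  rw [SpecialLinearGroup.ext_iff, coe_neg, coe_mul, coe_mul, coe_rightAngle]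
  simp only [Fin.forall_fin_two, Matrix.mul_apply, Fin.sum_univ_two, Matrix.neg_apply]
  simp
  grind

/-- The matrices commuting with the rotation by a right angle are parametrized by
the points of `x ^ 2 + y ^ 2 = 1`. -/
def commuteRightAngleEquiv :
    {g : SpecialLinearGroup (Fin 2) F // g * rightAngle F = rightAngle F * g} ≃
      TwoSquares F 1 where
  toFun g := ⟨(g.1 0 0, g.1 1 0), by
    obtain ⟨h₀, h₁⟩ := mul_rightAngle_eq_iff.mp g.2
    have hd := det_fin_two g.1.1
    rw [g.1.2, h₀, h₁] at hd
    linear_combination -hd⟩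
  invFun z := ⟨⟨!![z.1.1, -z.1.2; z.1.2, z.1.1], by
    rw [det_fin_two_of]
    linear_combination z.2⟩, mul_rightAngle_eq_iff.mpr ⟨rfl, rfl⟩⟩
  left_inv g := by
    obtain ⟨h₀, h₁⟩ := mul_rightAngle_eq_iff.mp g.2
    ext i j
    fin_cases i <;> fin_cases j <;> simp [h₀, h₁]
  right_inv z := by
    apply TwoSquares.ext <;> simp

/-- The matrices anticommuting with the rotation by a right angle are parametrized by
the points of `x ^ 2 + y ^ 2 = -1`. -/
def anticommuteRightAngleEquiv :
    {g : SpecialLinearGroup (Fin 2) F // g * rightAngle F = -(rightAngle F * g)} ≃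
      TwoSquares F (-1) where
  toFun g := ⟨(g.1 0 0, g.1 1 0), by
    obtain ⟨h₀, h₁⟩ := mul_rightAngle_eq_neg_iff.mp g.2
    have hd := det_fin_two g.1.1
    rw [g.1.2, h₀, h₁] at hd
    linear_combination hd⟩
  invFun z := ⟨⟨!![z.1.1, z.1.2; z.1.2, -z.1.1], by
    rw [det_fin_two_of]
    linear_combination -z.2⟩, mul_rightAngle_eq_neg_iff.mpr ⟨rfl, rfl⟩⟩
  left_inv g := by
    obtain ⟨h₀, h₁⟩ := mul_rightAngle_eq_neg_iff.mp g.2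
    ext i j
    fin_cases i <;> fin_cases j <;> simp [h₀, h₁]
  right_inv z := by
    apply TwoSquares.ext <;> simp

lemma mk_eq_mk_iff (g h : SpecialLinearGroup (Fin 2) F) :
    (g : PSL2 F) = h ↔ g = h ∨ g = -h := by
  rw [eq_comm, QuotientGroup.eq, mem_center_fin_two_iff, inv_mul_eq_iff_eq_mul,
    inv_mul_eq_iff_eq_mul]
  simp

lemma sq_eq_neg_one_of_orderOf_mk_eq_two (h2 : (2 : F) ≠ 0) {t : SpecialLinearGroup (Fin 2) F}
    (ht : orderOf (t : PSL2 F) = 2) :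
    t 0 0 ^ 2 + t 0 1 * t 1 0 = -1 ∧ t 1 1 = -t 0 0 := by
  obtain ⟨hsq, hne⟩ := orderOf_eq_prime_iff.mp ht
  have hne' : ¬ (t = 1 ∨ t = -1) := by
    rwa [← mk_eq_mk_iff]
  have hsq' : t ^ 2 = 1 ∨ t ^ 2 = -1 := by
    rw [← mk_eq_mk_iff]
    exact hsq
  have hd := det_fin_two t.1
  rw [t.2] at hd
  have entry (i j : Fin 2) : (t ^ 2) i j = t i 0 * t 0 j + t i 1 * t 1 j := by
    simp [pow_two, Matrix.mul_apply]
  rcases hsq' with h | h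
  · exfalso
    have h00 := entry 0 0
    have h01 := entry 0 1
    have h10 := entry 1 0
    simp [h] at h00 h01 h10
    have hmul : t 0 0 * (t 0 0 + t 1 1) = 2 := by linear_combination -h00 + -hd
    have htr : t 0 0 + t 1 1 ≠ 0 := fun h0 ↦ h2 (by rw [← hmul, h0, mul_zero])
    have hb : t 0 1 = 0 :=
      (mul_eq_zero.mp (by linear_combination -h01 : t 0 1 * (t 0 0 + t 1 1) = 0)).resolve_right htr
    have hc : t 1 0 = 0 :=
      (mul_eq_zero.mp (by linear_combination -h10 : t 1 0 * (t 0 0 + t 1 1) = 0)).resolve_right htr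
    have ha : t 0 0 ^ 2 = 1 := by linear_combination -h00 - t 1 0 * hb
    have had : t 1 1 = t 0 0 := by
      linear_combination -t 1 1 * ha - t 0 0 * hd + t 0 0 * t 1 0 * hb
    apply hne'
    rcases sq_eq_one_iff.mp ha with ha | ha
    · left
      ext i j
      fin_cases i <;> fin_cases j <;> simp [ha, hb, hc, had]
    · right
      ext i j
      fin_cases i <;> fin_cases j <;> simp [ha, hb, hc, had]
  · have h00 := entry 0 0
    have h01 := entry 0 1
    have h10 := entry 1 0
    simp [h] at h00 h01 h10
    refine ⟨by linear_combination -h00, ?_⟩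
    by_contra hne0
    have htr : t 0 0 + t 1 1 ≠ 0 := fun h0 ↦ hne0 (by linear_combination h0)
    have hb : t 0 1 = 0 :=
      (mul_eq_zero.mp (by linear_combination -h01 : t 0 1 * (t 0 0 + t 1 1) = 0)).resolve_right htr
    have ha : t 0 0 = 0 :=
      (mul_eq_zero.mp
        (by linear_combination -h00 - hd : t 0 0 * (t 0 0 + t 1 1) = 0)).resolve_right htr
    simp [ha, hb] at hd

lemma exists_conj_rightAngle_eq [Finite F] (hF : Nat.card F % 2 = 1) (h2 : (2 : F) ≠ 0)
    {t : SpecialLinearGroup (Fin 2) F}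
    (ht : t 0 0 ^ 2 + t 0 1 * t 1 0 = -1) (htr : t 1 1 = -t 0 0) :
    ∃ g : SpecialLinearGroup (Fin 2) F, t = g * rightAngle F * g⁻¹ := by
  obtain ⟨x, y, hxy⟩ : ∃ x y : F, t 1 0 * x ^ 2 - 2 * t 0 0 * x * y - t 0 1 * y ^ 2 = 1 := by
    by_cases hc : t 1 0 = 0
    · rw [hc, mul_zero, add_zero] at ht
      have ha : t 0 0 ≠ 0 := by
        intro ha
        simp [ha] at ht
      refine ⟨(-1 - t 0 1) / (2 * t 0 0), 1, ?_⟩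
      rw [hc]
      field_simp
      ring
    · obtain ⟨u, v, huv⟩ := exists_sq_add_sq_eq hF (t 1 0)
      refine ⟨(u + t 0 0 * v) / t 1 0, v, ?_⟩
      field_simp
      linear_combination huv - v ^ 2 * ht
  obtain ⟨g, hg⟩ : ∃ g : SpecialLinearGroup (Fin 2) F,
      (g : Matrix (Fin 2) (Fin 2) F) = !![x, t 0 0 * x + t 0 1 * y; y, t 1 0 * x + t 1 1 * y] := by
    refine ⟨⟨_, ?_⟩, rfl⟩
    rw [det_fin_two_of, htr]
    linear_combination hxy
  refine ⟨g, ?_⟩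
  rw [eq_mul_inv_iff_mul_eq, SpecialLinearGroup.ext_iff, coe_mul, coe_mul, hg, coe_rightAngle]
  simp only [Fin.forall_fin_two, Matrix.mul_apply, Fin.sum_univ_two]
  simp [htr]
  constructor
  · linear_combination x * ht
  · linear_combination y * ht

lemma card_centralizer_mk_rightAngle [Finite F] (hF : Nat.card F % 2 = 1) (h2 : (2 : F) ≠ 0) :
    Nat.card (Subgroup.centralizer {(rightAngle F : PSL2 F)}) = Nat.card (TwoSquares F 1) := by
  have hpre : (QuotientGroup.mk ⁻¹'
      (Subgroup.centralizer {(rightAngle F : PSL2 F)} : Set (PSL2 F)) :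
      Set (SpecialLinearGroup (Fin 2) F)) =
      {g | g * rightAngle F = rightAngle F * g} ∪ {g | g * rightAngle F = -(rightAngle F * g)} := by
    ext g
    rw [Set.mem_preimage, SetLike.mem_coe, Subgroup.mem_centralizer_singleton_iff,
      ← QuotientGroup.mk_mul, ← QuotientGroup.mk_mul, mk_eq_mk_iff]
    rfl
  have hdisj : Disjoint {g | g * rightAngle F = rightAngle F * g}
      {g | g * rightAngle F = -(rightAngle F * g)} := by
    rw [Set.disjoint_left]
    intro g h₁ h₂
    refine one_ne_neg_one h2 (mul_left_cancel (a := rightAngle F * g) ?_)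
    rw [Set.mem_ofPred_eq] at h₁ h₂
    rw [mul_one, mul_neg, mul_one, ← h₂, h₁]
  have h := QuotientGroup.card_preimage_mk (Subgroup.center (SpecialLinearGroup (Fin 2) F))
    (Subgroup.centralizer {(rightAngle F : PSL2 F)} : Set (PSL2 F))
  rw [hpre, Nat.card_coe_set_eq, Set.ncard_union_eq hdisj, ← Nat.card_coe_set_eq,
    ← Nat.card_coe_set_eq, card_center_fin_two h2, Set.coe_ofPred, Set.coe_ofPred,
    Nat.card_congr commuteRightAngleEquiv, Nat.card_congr anticommuteRightAngleEquiv,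
    card_twoSquares_eq_card_one hF (neg_ne_zero.mpr one_ne_zero)] at h
  rw [SetLike.coe_sort_coe] at h
  omega

lemma card_centralizer_of_orderOf_eq_two [Finite F] (hF : Nat.card F % 2 = 1) (h2 : (2 : F) ≠ 0)
    {i : PSL2 F} (hi : orderOf i = 2) :
    Nat.card (Subgroup.centralizer {i}) = Nat.card (TwoSquares F 1) := by
  obtain ⟨t, rfl⟩ := QuotientGroup.mk_surjective i
  obtain ⟨ht, htr⟩ := sq_eq_neg_one_of_orderOf_mk_eq_two h2 hi
  obtain ⟨g, rfl⟩ := exists_conj_rightAngle_eq hF h2 ht htr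
  rw [QuotientGroup.mk_mul, QuotientGroup.mk_mul, QuotientGroup.mk_inv,
    Subgroup.card_centralizer_singleton_conj, card_centralizer_mk_rightAngle hF h2]

end Matrix.SpecialLinearGroup

/-- In `H = PSL₂(𝔽_q)`, `q` an odd prime power, the centralizer of any
involution has cardinality `q - 1` if `q ≡ 1 (mod 4)` and `q + 1` if
`q ≡ 3 (mod 4)`; i.e. `|C_H(i)| = 2b` with `b` the even one of `(q∓1)/2`. -/
theorem card_centralizer_involution_PSL2
    (p : ℕ) [Fact p.Prime] (hp : Odd p) (k : ℕ) (hk : 0 < k)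
    (q : ℕ) (hq : q = p ^ k)
    (i : PSL2 (GaloisField p k)) (hi : orderOf i = 2) :
    (q % 4 = 1 →
      Nat.card (Subgroup.centralizer {i} : Subgroup (PSL2 (GaloisField p k))) = q - 1) ∧
    (q % 4 = 3 →
      Nat.card (Subgroup.centralizer {i} : Subgroup (PSL2 (GaloisField p k))) = q + 1) := by
  have hcard : Nat.card (GaloisField p k) = q := by rw [GaloisField.card p k hk.ne', hq]
  have hF : Nat.card (GaloisField p k) % 2 = 1 := by
    rw [hcard, hq, ← Nat.odd_iff]
    exact hp.pow
  have h2 : (2 : GaloisField p k) ≠ 0 := by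
    refine Ring.two_ne_zero ?_
    rw [ringChar.eq (GaloisField p k) p]
    rintro rfl
    exact absurd hp (by decide)
  have := Fintype.ofFinite (GaloisField p k)
  rw [Matrix.SpecialLinearGroup.card_centralizer_of_orderOf_eq_two hF h2 hi, ← hcard]
  have hsq := FiniteField.isSquare_neg_one_iff (F := GaloisField p k)
  rw [← Nat.card_eq_fintype_card] at hsq
  refine ⟨fun h ↦ card_twoSquares_one_of_isSquare h2 (hsq.mpr (by omega)), fun h ↦ ?_⟩
  exact card_twoSquares_one_of_not_isSquare hF fun h' ↦ hsq.mp h' h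
end

section
/- Let q be an odd prime power and let H = PSL₂(𝔽_q). Then any two involutions of H are conjugate in H; that is, for all i, j ∈ H with i² = j² = 1 and i ≠ 1 ≠ j, there exists g ∈ H with g⁻¹·i·g = j. -/
open Matrix

/-- Every element of a finite field of odd characteristic is a sum of two squares. -/
theorem exists_sq_add_sq_eq_s7 {F : Type*} [Field F] [Finite F] (h2 : (2 : F) ≠ 0) (c : F) :
    ∃ x y : F, x ^ 2 + y ^ 2 = c := by
  have := Fintype.ofFinite F
  have hodd : Fintype.card F % 2 = 1 :=
    FiniteField.odd_card_of_char_ne_two fun h => h2 <| by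
      simpa [h] using CharP.cast_eq_zero F (ringChar F)
  obtain ⟨x, y, hxy⟩ := FiniteField.exists_root_sum_quadratic
    (f := Polynomial.X ^ 2) (g := Polynomial.X ^ 2 - Polynomial.C c)
    (Polynomial.degree_X_pow 2) (Polynomial.degree_X_pow_sub_C two_pos c) hodd
  refine ⟨x, y, ?_⟩
  simp only [Polynomial.eval_pow, Polynomial.eval_X, Polynomial.eval_sub, Polynomial.eval_C] at hxy
  linear_combination hxy

/-- The binary form `v ↦ det (v, A v)` of a trace-zero matrix `A = !![a, b; c, -a]` of
determinant one represents `1` over a finite field of odd characteristic. -/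
theorem exists_form_eq_one {F : Type*} [Field F] [Finite F] (h2 : (2 : F) ≠ 0) {a b c : F}
    (h : a * -a - b * c = 1) : ∃ x y : F, x * (c * x - a * y) - (a * x + b * y) * y = 1 := by
  by_cases hc : c = 0
  · subst hc
    have ha : a ≠ 0 := by rintro rfl; simp at h
    refine ⟨-(1 + b) / (2 * a), 1, ?_⟩
    field_simp
    ring
  · obtain ⟨u, y, huy⟩ := exists_sq_add_sq_eq_s7 h2 c
    refine ⟨(u + a * y) / c, y, ?_⟩
    field_simp
    linear_combination huy + y ^ 2 * h

/-- The matrix `!![0, -1; 1, 0]` as an element of `SL₂`. -/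
def quarterTurn (F : Type*) [Field F] : SpecialLinearGroup (Fin 2) F :=
  ⟨!![0, -1; 1, 0], by simp [det_fin_two_of]⟩

theorem coe_quarterTurn (F : Type*) [Field F] :
    (quarterTurn F : Matrix (Fin 2) (Fin 2) F) = !![0, -1; 1, 0] := rfl

/-- Over a finite field of odd characteristic, every trace-zero element of `SL₂` is conjugate
to `!![0, -1; 1, 0]`. -/
theorem isConj_of_trace_eq_zero {F : Type*} [Field F] [Finite F] (h2 : (2 : F) ≠ 0)
    (A : SpecialLinearGroup (Fin 2) F) (hA : A 0 0 + A 1 1 = 0) :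
    IsConj A (quarterTurn F) := by
  have hd : A 1 1 = -A 0 0 := by linear_combination hA
  have hdet : A 0 0 * -A 0 0 - A 0 1 * A 1 0 = 1 := by
    rw [← hd, ← det_fin_two]; exact A.det_coe
  obtain ⟨x, y, hxy⟩ := exists_form_eq_one h2 hdet
  obtain ⟨P, hP⟩ : ∃ P : SpecialLinearGroup (Fin 2) F, (P : Matrix (Fin 2) (Fin 2) F) =
      !![x, A 0 0 * x + A 0 1 * y; y, A 1 0 * x - A 0 0 * y] :=
    ⟨⟨_, by rw [det_fin_two_of, hxy]⟩, rfl⟩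
  refine IsConj.symm (isConj_iff.2 ⟨P, mul_inv_eq_iff_eq_mul.2 ?_⟩)
  ext i j
  rw [Matrix.SpecialLinearGroup.coe_mul, Matrix.SpecialLinearGroup.coe_mul, hP, coe_quarterTurn]
  fin_cases i <;> fin_cases j <;> simp [mul_apply, Fin.sum_univ_two, hd]
  · linear_combination x * hdet
  · ring
  · linear_combination y * hdet

/-- An element of `SL₂` over a field whose square is central is central or has trace zero. -/
theorem mem_center_or_trace_eq_zero {F : Type*} [Field F] (A : SpecialLinearGroup (Fin 2) F)
    (hA : A ^ 2 ∈ Subgroup.center (SpecialLinearGroup (Fin 2) F)) :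
    A ∈ Subgroup.center (SpecialLinearGroup (Fin 2) F) ∨ A 0 0 + A 1 1 = 0 := by
  refine or_iff_not_imp_right.2 fun ht => ?_
  have hdet : A 0 0 * A 1 1 - A 0 1 * A 1 0 = 1 := by
    rw [← det_fin_two]; exact A.det_coe
  obtain ⟨r, -, hr⟩ := Matrix.SpecialLinearGroup.mem_center_iff.1 hA
  have entry (i j : Fin 2) := congr_fun (congr_fun hr i) j
  have h01 := entry 0 1
  have h10 := entry 1 0
  have h00 := entry 0 0
  have h11 := entry 1 1
  simp [pow_two, mul_apply, Fin.sum_univ_two] at h00 h01 h10 h11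
  have e01 : A 0 1 = 0 := by
    refine (mul_eq_zero.1 ?_).resolve_left ht; linear_combination -h01
  have e10 : A 1 0 = 0 := by
    refine (mul_eq_zero.1 ?_).resolve_left ht; linear_combination -h10
  have e11 : A 1 1 = A 0 0 := by
    refine sub_eq_zero.1 ((mul_eq_zero.1 ?_).resolve_left ht); linear_combination h00 - h11
  refine Matrix.SpecialLinearGroup.mem_center_iff.2 ⟨A 0 0, ?_, ?_⟩
  · rw [e01, e11] at hdet
    simp only [Fintype.card_fin]
    linear_combination hdet
  · ext i j
    fin_cases i <;> fin_cases j <;> simp [e01, e10, e11]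

/-- Over a finite field of odd characteristic, every involution of `PSL₂` is conjugate to the
class of `!![0, -1; 1, 0]`. -/
theorem PSL2.isConj_of_sq_eq_one {F : Type*} [Field F] [Finite F] (h2 : (2 : F) ≠ 0)
    (i : PSL2 F) (hi2 : i ^ 2 = 1) (hi1 : i ≠ 1) :
    IsConj i (QuotientGroup.mk (quarterTurn F) : PSL2 F) := by
  obtain ⟨A, rfl⟩ := QuotientGroup.mk_surjective i
  rw [← QuotientGroup.mk_pow, QuotientGroup.eq_one_iff] at hi2
  rw [Ne, QuotientGroup.eq_one_iff] at hi1
  exact (QuotientGroup.mk' _).map_isConj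
    (isConj_of_trace_eq_zero h2 A ((mem_center_or_trace_eq_zero A hi2).resolve_left hi1))

/-- In `H = PSL₂(𝔽_q)`, `q` an odd prime power, any two involutions are
conjugate. -/
theorem involutions_conjugate_PSL2
    (p : ℕ) [Fact p.Prime] (hp : Odd p) (k : ℕ) (hk : 0 < k)
    (i j : PSL2 (GaloisField p k))
    (hi2 : i ^ 2 = 1) (hj2 : j ^ 2 = 1) (hi1 : i ≠ 1) (hj1 : j ≠ 1) :
    ∃ g : PSL2 (GaloisField p k), g⁻¹ * i * g = j := by
  have h2 : (2 : GaloisField p k) ≠ 0 := by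
    intro h
    have hdvd : p ∣ 2 := (CharP.cast_eq_zero_iff (GaloisField p k) p 2).1 (mod_cast h)
    rw [(Nat.prime_dvd_prime_iff_eq Fact.out Nat.prime_two).1 hdvd] at hp
    exact absurd hp (by decide)
  obtain ⟨c, hc⟩ := isConj_iff.1 ((PSL2.isConj_of_sq_eq_one h2 i hi2 hi1).trans
    (PSL2.isConj_of_sq_eq_one h2 j hj2 hj1).symm)
  exact ⟨c⁻¹, by rw [inv_inv, hc]⟩
end

section
/- Let q ≥ 5 be an odd prime power, let H = PSL₂(𝔽_q), let a denote whichever of (q−1)/2 and (q+1)/2 is odd and b the other one. Then the number of cyclic subgroups of H of cardinality a equals b·q. -/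
open Matrix

/-- If `a` is odd and `N` is a central subgroup of exponent dividing two, then `G` and `G ⧸ N`
have the same number of elements of order `a`. -/
theorem card_orderOf_eq_quotient_of_odd {G : Type*} [Group G] (N : Subgroup G) [N.Normal]
    (hN : N ≤ Subgroup.center G) (hN2 : ∀ z ∈ N, z ^ 2 = 1) {a : ℕ} (ha : Odd a) :
    Nat.card {x : G ⧸ N // orderOf x = a} = Nat.card {g : G // orderOf g = a} := by
  have key : ∀ g : G, orderOf g = a → orderOf (g : G ⧸ N) = a := by
    intro g hg
    refine Nat.dvd_antisymm (hg ▸ orderOf_map_dvd (QuotientGroup.mk' N) g) ?_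
    have h1 : g ^ orderOf (g : G ⧸ N) ∈ N := by
      rw [← QuotientGroup.eq_one_iff, QuotientGroup.mk_pow, pow_orderOf_eq_one]
    have h2 := hN2 _ h1
    rw [← pow_mul] at h2
    exact ((Nat.coprime_two_right.2 ha).dvd_of_dvd_mul_right
      (hg ▸ orderOf_dvd_of_pow_eq_one h2))
  symm
  refine Nat.card_congr (Equiv.ofBijective (fun g => ⟨(g.1 : G ⧸ N), key g.1 g.2⟩) ⟨?_, ?_⟩)
  · rintro ⟨g, hg⟩ ⟨h, hh⟩ hgh
    simp only [Subtype.mk.injEq] at hgh ⊢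
    rw [QuotientGroup.eq] at hgh
    have hz := hN2 _ hgh
    have hc : Commute g⁻¹ h := by
      have := Subgroup.mem_center_iff.1 (hN hgh) g
      have h3 : h = g⁻¹ * h * g := by rw [← this]; group
      change g⁻¹ * h = h * g⁻¹
      conv_rhs => rw [h3]
      group
    have hza : (g⁻¹ * h) ^ a = 1 := by
      rw [hc.mul_pow, inv_pow]
      nth_rw 1 [← hg]
      rw [← hh, pow_orderOf_eq_one, pow_orderOf_eq_one]; simp
    have := pow_gcd_eq_one.2 ⟨hz, hza⟩
    rw [(Nat.coprime_two_left.2 ha).gcd_eq_one, pow_one] at this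
    exact inv_mul_eq_one.1 this
  · rintro ⟨x, hx⟩
    induction x using QuotientGroup.induction_on with | H g => ?_
    have h1 : g ^ a ∈ N := by
      rw [← QuotientGroup.eq_one_iff, QuotientGroup.mk_pow]
      nth_rw 1 [← hx]; rw [pow_orderOf_eq_one]
    have hmk : ((g ^ (a + 1) : G) : G ⧸ N) = g := by
      rw [QuotientGroup.mk_pow, pow_succ]
      nth_rw 1 [← hx]; rw [pow_orderOf_eq_one, one_mul]
    have h2 : (g ^ (a + 1)) ^ a = 1 := by
      obtain ⟨c, hc⟩ := ha.add_one
      rw [← pow_mul, mul_comm, pow_mul, hc, ← two_mul, pow_mul, hN2 _ h1, one_pow]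
    refine ⟨⟨g ^ (a + 1), Nat.dvd_antisymm (orderOf_dvd_of_pow_eq_one h2) ?_⟩, Subtype.ext hmk⟩
    have := orderOf_map_dvd (QuotientGroup.mk' N) (g ^ (a + 1))
    rwa [QuotientGroup.mk'_apply, hmk, hx] at this

/-- Each cyclic subgroup of order `a` has `φ a` generators, each of order `a`. -/
theorem card_cyclic_subgroups_mul_totient {G : Type*} [Group G] [Finite G] (a : ℕ) :
    Nat.card {T : Subgroup G // IsCyclic T ∧ Nat.card T = a} * a.totient =
      Nat.card {g : G // orderOf g = a} := by
  classical
  have := Fintype.ofFinite G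
  have := Fintype.ofFinite (Subgroup G)
  let e : {g : G // orderOf g = a} ≃
      Σ T : {T : Subgroup G // IsCyclic T ∧ Nat.card T = a}, {x : T.1 // orderOf x = a} :=
    { toFun g := ⟨⟨Subgroup.zpowers g.1, inferInstance, by rw [Nat.card_zpowers, g.2]⟩,
        ⟨⟨g.1, Subgroup.mem_zpowers g.1⟩, by rw [Subgroup.orderOf_mk, g.2]⟩⟩
      invFun x := ⟨x.2.1.1, by rw [Subgroup.orderOf_coe, x.2.2]⟩
      left_inv g := rfl
      right_inv := by
        rintro ⟨⟨T, hT, hTa⟩, ⟨x, hxT⟩, hx⟩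
        have hz : Subgroup.zpowers x = T := by
          refine Subgroup.eq_of_le_of_card_ge (by simpa using hxT) ?_
          rw [hTa, Nat.card_zpowers, ← hx, Subgroup.orderOf_mk]
        subst hz
        rfl }
  rw [Nat.card_congr e, Nat.card_sigma]
  rw [Finset.sum_congr rfl (g := fun _ => a.totient), Finset.sum_const, smul_eq_mul,
    Nat.card_eq_fintype_card, Finset.card_univ]
  rintro ⟨T, hT, hTa⟩ -
  have := IsCyclic.card_orderOf_eq_totient (α := T) (d := a)
    (by rw [← hTa, Nat.card_eq_fintype_card])
  rw [← this, Nat.card_eq_fintype_card, Fintype.card_subtype]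

/-- The number of solutions `z` of `y * z = c` in a finite field. -/
theorem card_filter_mul_eq {F : Type*} [Field F] [Fintype F] [DecidableEq F] (y c : F) :
    (Finset.univ.filter fun z : F => y * z = c).card =
      if y = 0 then (if c = 0 then Fintype.card F else 0) else 1 := by
  split_ifs with hy hc
  · subst hy hc; simp
  · subst hy; simp [Ne.symm hc]
  · rw [Finset.card_eq_one]
    refine ⟨y⁻¹ * c, ?_⟩
    ext z
    simp only [Finset.mem_filter_univ, Finset.mem_singleton]
    rw [eq_inv_mul_iff_mul_eq₀ hy]

/-- The number of matrices of trace `t` in `SL₂(F)`, in terms of the number of eigenvalues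
in `F`. -/
theorem card_SL2_trace_eq {F : Type*} [Field F] [Fintype F] [DecidableEq F] (t : F) :
    Nat.card {M : SpecialLinearGroup (Fin 2) F // M.1.trace = t} =
      Fintype.card F * (Fintype.card F - 1) +
        (Finset.univ.filter fun x : F => x * (t - x) - 1 = 0).card * Fintype.card F := by
  let e : {M : SpecialLinearGroup (Fin 2) F // M.1.trace = t} ≃
      {v : F × F × F // v.2.1 * v.2.2 = v.1 * (t - v.1) - 1} :=
    { toFun M := ⟨(M.1 0 0, M.1 0 1, M.1 1 0), by
        have h1 := M.1.2
        have h2 := M.2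
        rw [det_fin_two] at h1
        rw [trace_fin_two] at h2
        simp only [← h2]
        linear_combination -h1⟩
      invFun v := ⟨⟨!![v.1.1, v.1.2.1; v.1.2.2, t - v.1.1], by
        rw [det_fin_two_of, v.2]; ring⟩, by simp [trace_fin_two]⟩
      left_inv M := by
        have h2 := M.2
        rw [trace_fin_two] at h2
        ext i j
        fin_cases i <;> fin_cases j <;> simp [← h2]
      right_inv v := rfl }
  rw [Nat.card_congr e, Nat.card_eq_fintype_card, Fintype.card_subtype, Finset.card_filter,
    Fintype.sum_prod_type]
  simp_rw [Fintype.sum_prod_type, ← Finset.card_filter, card_filter_mul_eq]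
  have h (c : F) : (∑ y : F, if y = 0 then (if c = 0 then Fintype.card F else 0) else 1) =
      (Fintype.card F - 1) + if c = 0 then Fintype.card F else 0 := by
    rw [Finset.sum_ite, Finset.filter_ne', Finset.sum_const, Finset.sum_const]
    simp [Finset.filter_eq', add_comm]
  simp_rw [h, Finset.sum_add_distrib, Finset.sum_ite]
  simp

theorem SL2_pow_eq_one_iff {F : Type*} [Field F] (M : SpecialLinearGroup (Fin 2) F) (n : ℕ) :
    M ^ n = 1 ↔ (M : Matrix (Fin 2) (Fin 2) F) ^ n = 1 :=
  Subtype.ext_iff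

/-- A matrix `M` in `SL₂` with distinct eigenvalues `ζ`, `ζ⁻¹` has the same order as `ζ`. -/
theorem orderOf_SL2_eq_of_trace {F L : Type*} [Field F] [Field L] [Algebra F L]
    (M : SpecialLinearGroup (Fin 2) F) {ζ : L} (h0 : ζ ≠ 0) (h : ζ ≠ ζ⁻¹)
    (ht : algebraMap F L (M : Matrix (Fin 2) (Fin 2) F).trace = ζ + ζ⁻¹) : orderOf M = orderOf ζ := by
  let N : Matrix (Fin 2) (Fin 2) L := (M : Matrix (Fin 2) (Fin 2) F).map (algebraMap F L)
  have hN : N.charpoly = (Polynomial.X - Polynomial.C ζ) * (Polynomial.X - Polynomial.C ζ⁻¹) := by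
    have hd : N.det = 1 := by
      have := RingHom.map_det (algebraMap F L) (M : Matrix (Fin 2) (Fin 2) F)
      rw [M.det_coe, map_one] at this
      exact this.symm
    have htr : N.trace = ζ + ζ⁻¹ := by
      rw [← ht]; simp [N, trace_fin_two]
    rw [charpoly_fin_two, htr, hd, Polynomial.C_add, ← mul_inv_cancel₀ h0, Polynomial.C_mul]
    ring
  have hMN (n : ℕ) : M ^ n = 1 ↔ N ^ n = 1 := by
    rw [SL2_pow_eq_one_iff, ← Matrix.map_pow,
      ← (Matrix.map_injective (algebraMap F L).injective).eq_iff, Matrix.map_one _ (map_zero _)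
      (map_one _)]
  refine orderOf_eq_orderOf_iff.2 fun n => (hMN n).trans ⟨fun hn => ?_, fun hn => ?_⟩
  · have hdet : (N - Matrix.scalar (Fin 2) ζ).det = 0 := by
      have := Matrix.eval_charpoly N ζ
      rw [hN] at this
      rw [← neg_sub, Matrix.det_neg, ← this]; simp
    obtain ⟨v, hv, hNv⟩ := exists_mulVec_eq_zero_iff.2 hdet
    have hNv' : N *ᵥ v = ζ • v := by
      rw [sub_mulVec, sub_eq_zero] at hNv
      rw [hNv]; ext i; simp [Matrix.scalar_apply, mulVec_diagonal]
    have hpow (m : ℕ) : (N ^ m) *ᵥ v = ζ ^ m • v := by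
      induction m with
      | zero => simp
      | succ m ih => rw [pow_succ, ← mulVec_mulVec, hNv', mulVec_smul, ih, smul_smul, pow_succ']
    have h1 := hpow n
    rw [hn, one_mulVec] at h1
    have : (ζ ^ n - 1) • v = 0 := by rw [sub_smul, ← h1, one_smul, sub_self]
    exact sub_eq_zero.1 ((smul_eq_zero.1 this).resolve_right hv)
  · have hdvd : N.charpoly ∣ (Polynomial.X ^ n - 1 : Polynomial L) := by
      rw [hN]
      refine IsCoprime.mul_dvd (Polynomial.isCoprime_X_sub_C_of_isUnit_sub
        (sub_ne_zero.2 h).isUnit) ?_ ?_ <;> rw [Polynomial.dvd_iff_isRoot] <;> simp [hn]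
    obtain ⟨r, hr⟩ := hdvd
    have := congrArg (Polynomial.aeval N) hr
    rw [map_mul, Matrix.aeval_self_charpoly, zero_mul] at this
    simpa [sub_eq_zero] using this

/-- A unipotent `2 × 2` matrix whose `n`-th power is trivial, with `n` prime to the
characteristic, is trivial. -/
theorem eq_one_of_trace_eq_two_of_pow_eq_one {F : Type*} [Field F] (M : Matrix (Fin 2) (Fin 2) F)
    (hd : M.det = 1) (ht : M.trace = 2) {n : ℕ} (hn : (n : F) ≠ 0) (hM : M ^ n = 1) : M = 1 := by
  have hsq : (M - 1) * (M - 1) = 0 := by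
    have h1 := M.aeval_self_charpoly
    rw [charpoly_fin_two, ht, hd] at h1
    simp only [map_ofNat, map_one, map_add, map_sub, map_mul, map_pow, Polynomial.aeval_X] at h1
    rw [← h1]; noncomm_ring
  have hpow (m : ℕ) : M ^ m = 1 + m • (M - 1) := by
    induction m with
    | zero => simp
    | succ m ih =>
      have : M ^ (m + 1) = M ^ m * (1 + (M - 1)) := by rw [pow_succ]; simp
      rw [this, ih, add_mul, mul_add, mul_add, smul_mul_assoc m (M - 1) (M - 1), hsq, succ_nsmul]
      simp only [mul_one, one_mul, smul_zero, add_zero]; abel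
  have h1 := hpow n
  rw [hM, left_eq_add, ← Nat.cast_smul_eq_nsmul F, smul_eq_zero, sub_eq_zero] at h1
  exact h1.resolve_left hn

/-- In an extension of `𝔽_q`, the solutions of `x ^ q = x` lie in `𝔽_q`. -/
theorem mem_range_algebraMap_of_pow_card {F L : Type*} [Field F] [Fintype F] [Field L]
    [Algebra F L] {x : L} (hx : x ^ Fintype.card F = x) : ∃ y : F, algebraMap F L y = x := by
  have h1 : (Polynomial.X ^ Fintype.card F - Polynomial.X : Polynomial F).Splits := by
    rw [Polynomial.splits_iff_card_roots, FiniteField.roots_X_pow_card_sub_X,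
      FiniteField.X_pow_card_sub_X_natDegree_eq F Fintype.one_lt_card]
    rfl
  have h2 := h1.roots_map (algebraMap F L)
  rw [FiniteField.roots_X_pow_card_sub_X] at h2
  have h3 : x ∈ (Polynomial.map (algebraMap F L)
      (Polynomial.X ^ Fintype.card F - Polynomial.X : Polynomial F)).roots := by
    rw [Polynomial.mem_roots']
    refine ⟨Polynomial.map_ne_zero (FiniteField.X_pow_card_sub_X_ne_zero F Fintype.one_lt_card), ?_⟩
    simp [hx]
  rw [h2] at h3
  simpa using h3

theorem IsPrimitiveRoot.ne_inv {L : Type*} [Field L] {ζ : L} {a : ℕ} (h : IsPrimitiveRoot ζ a)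
    (ha : 3 ≤ a) : ζ ≠ ζ⁻¹ := by
  intro hζ
  have h1 : ζ ^ 2 = 1 := by
    rw [sq]; nth_rw 2 [hζ]; exact mul_inv_cancel₀ (h.ne_zero (by omega))
  have := Nat.le_of_dvd two_pos (h.dvd_of_pow_eq_one _ h1)
  omega

/-- For a primitive `a`-th root of unity `ζ`, with `a = (q ∓ 1) / 2`, the number of elements of
`SL₂(𝔽_q)` with trace `ζ + ζ⁻¹` is `q (q ± 1)`. -/
theorem card_SL2_trace_eq_add_inv {F L : Type*} [Field F] [Fintype F] [Field L] [Algebra F L]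
    {a b : ℕ} (ha3 : 3 ≤ a)
    (hab : (Fintype.card F = 2 * a + 1 ∧ b = a + 1) ∨ (Fintype.card F + 1 = 2 * a ∧ b + 1 = a))
    {ζ : L} (h : IsPrimitiveRoot ζ a) :
    Nat.card {M : SpecialLinearGroup (Fin 2) F // algebraMap F L M.1.trace = ζ + ζ⁻¹} =
      2 * b * Fintype.card F := by
  classical
  have h0 : ζ ≠ 0 := h.ne_zero (by omega)
  have hne := h.ne_inv ha3
  have hmul : ζ * ζ⁻¹ = 1 := mul_inv_cancel₀ h0
  have hq : (ζ ^ Fintype.card F = ζ ∧ b = a + 1 ∧ Fintype.card F = 2 * a + 1) ∨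
      (ζ ^ Fintype.card F = ζ⁻¹ ∧ b + 1 = a ∧ Fintype.card F + 1 = 2 * a) := by
    rcases hab with ⟨h1, h2⟩ | ⟨h1, h2⟩
    · refine Or.inl ⟨?_, h2, h1⟩
      rw [h1, pow_succ, mul_comm 2, pow_mul, h.pow_eq_one, one_pow, one_mul]
    · refine Or.inr ⟨?_, h2, h1⟩
      rw [← mul_eq_one_iff_eq_inv₀ h0, ← pow_succ, h1, mul_comm 2, pow_mul, h.pow_eq_one, one_pow]
  obtain ⟨t, ht⟩ : ∃ t : F, algebraMap F L t = ζ + ζ⁻¹ := by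
    refine mem_range_algebraMap_of_pow_card ?_
    have := map_add (FiniteField.frobeniusAlgHom F L) ζ ζ⁻¹
    simp only [FiniteField.coe_frobeniusAlgHom, inv_pow] at this
    rw [this]
    rcases hq with ⟨h1, -⟩ | ⟨h1, -⟩ <;> rw [h1]
    rw [inv_inv, add_comm]
  have hroot (x : F) : x * (t - x) - 1 = 0 ↔ algebraMap F L x = ζ ∨ algebraMap F L x = ζ⁻¹ := by
    rw [← (algebraMap F L).injective.eq_iff, ← sub_eq_zero (b := ζ), ← sub_eq_zero (b := ζ⁻¹),
      ← mul_eq_zero, ← neg_eq_zero (a := _ * _)]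
    simp only [map_sub, map_mul, map_one, map_zero, ht]
    rw [← hmul]
    ring_nf
  simp_rw [← ht, (algebraMap F L).injective.eq_iff]
  rw [card_SL2_trace_eq]
  rcases hq with ⟨h1, h2, h3⟩ | ⟨h1, h2, h3⟩
  · obtain ⟨z, hz⟩ := mem_range_algebraMap_of_pow_card h1
    have hcard : (Finset.univ.filter fun x : F => x * (t - x) - 1 = 0).card = 2 := by
      rw [Finset.card_eq_two]
      refine ⟨z, z⁻¹, fun hzz => hne ?_, ?_⟩
      · rw [← hz, ← map_inv₀, ← hzz]
      · ext x
        rw [Finset.mem_filter_univ, hroot, ← hz, ← map_inv₀]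
        simp only [(algebraMap F L).injective.eq_iff, Finset.mem_insert, Finset.mem_singleton]
    rw [hcard, h3, h2, Nat.add_sub_cancel]
    ring
  · have hcard : (Finset.univ.filter fun x : F => x * (t - x) - 1 = 0).card = 0 := by
      rw [Finset.card_eq_zero, Finset.filter_eq_empty_iff]
      intro x _ hx
      have hxq : algebraMap F L x ^ Fintype.card F = algebraMap F L x := by
        rw [← map_pow, FiniteField.pow_card]
      rcases (hroot x).1 hx with hx | hx <;> rw [hx] at hxq
      · exact hne (hxq.symm.trans h1)
      · rw [inv_pow, h1, inv_inv] at hxq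
        exact hne hxq
    rw [hcard, zero_mul, add_zero, mul_comm, show Fintype.card F - 1 = 2 * b by omega]

/-- The eigenvalues of an element of `SL₂(F)` of odd order `a ≥ 3` prime to the characteristic are
a primitive `a`-th root of unity and its inverse. -/
theorem exists_isPrimitiveRoot_trace_eq {F L : Type*} [Field F] [Field L] [IsAlgClosed L]
    [Algebra F L] {a : ℕ} (ha : Odd a) (ha3 : 3 ≤ a) (haF : (a : F) ≠ 0)
    (M : SpecialLinearGroup (Fin 2) F) (hM : orderOf M = a) :
    ∃ ζ : L, IsPrimitiveRoot ζ a ∧ algebraMap F L M.1.trace = ζ + ζ⁻¹ := by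
  obtain ⟨ζ, hζ⟩ := IsAlgClosed.exists_eval₂_eq_zero_of_injective (RingHom.id L)
    (RingHom.id L).injective
    (Polynomial.X ^ 2 - Polynomial.C (algebraMap F L M.1.trace) * Polynomial.X + Polynomial.C 1)
    (by
      have : (Polynomial.X ^ 2 - Polynomial.C (algebraMap F L M.1.trace) * Polynomial.X +
        Polynomial.C 1 : Polynomial L).degree = 2 := by compute_degree!
      rw [this]; decide)
  simp only [Polynomial.eval₂_id, Polynomial.eval_add, Polynomial.eval_sub, Polynomial.eval_mul,
    Polynomial.eval_pow, Polynomial.eval_X, Polynomial.eval_C] at hζ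
  have h0 : ζ ≠ 0 := by rintro rfl; simp at hζ
  have ht : algebraMap F L M.1.trace = ζ + ζ⁻¹ := by
    field_simp
    linear_combination -hζ
  refine ⟨ζ, ?_, ht⟩
  by_cases hne : ζ = ζ⁻¹
  · exfalso
    have hsq : ζ * ζ = 1 := by nth_rw 2 [hne]; exact mul_inv_cancel₀ h0
    have hMa : M.1 ^ a = 1 := (SL2_pow_eq_one_iff M a).1 (hM ▸ pow_orderOf_eq_one M)
    have hM1 : M.1 ≠ 1 := by
      intro h
      rw [show M = 1 from Subtype.ext h, orderOf_one] at hM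
      omega
    rcases mul_self_eq_one_iff.1 hsq with rfl | rfl
    · have htr : M.1.trace = 2 := (algebraMap F L).injective (by
        rw [ht, map_ofNat, inv_one, one_add_one_eq_two])
      exact hM1 (eq_one_of_trace_eq_two_of_pow_eq_one M.1 M.2 htr haF hMa)
    · have htr : M.1.trace = -2 := (algebraMap F L).injective (by
        rw [ht, map_neg, map_ofNat, inv_neg, inv_one]; ring)
      by_cases h2 : (2 : F) = 0
      · exact hM1 (eq_one_of_trace_eq_two_of_pow_eq_one M.1 M.2
          (by rw [htr, h2, neg_zero]) haF hMa)
      · have hpow : (-M.1) ^ (2 * a) = 1 := by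
          rw [(even_two_mul a).neg_pow, mul_comm, pow_mul, hMa, one_pow]
        have h1 := eq_one_of_trace_eq_two_of_pow_eq_one (-M.1)
          (by rw [det_neg, M.2]; simp) (by rw [trace_neg, htr, neg_neg])
          (by push_cast; exact mul_ne_zero h2 haF) hpow
        rw [neg_eq_iff_eq_neg] at h1
        rw [h1, ha.neg_pow, one_pow, ← h1] at hMa
        exact hM1 hMa
  · rw [← hM, orderOf_SL2_eq_of_trace M h0 hne ht]
    exact IsPrimitiveRoot.orderOf ζ

/-- The number of elements of order `a` in `SL₂(𝔽_q)`. -/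
theorem card_orderOf_SL2 {F : Type*} [Field F] [Fintype F] {a b : ℕ} (ha : Odd a) (ha3 : 3 ≤ a)
    (hab : (Fintype.card F = 2 * a + 1 ∧ b = a + 1) ∨ (Fintype.card F + 1 = 2 * a ∧ b + 1 = a)) :
    Nat.card {M : SpecialLinearGroup (Fin 2) F // orderOf M = a} =
      b * Fintype.card F * a.totient := by
  classical
  let L := AlgebraicClosure F
  have haF : (a : F) ≠ 0 := by
    intro h
    rcases hab with ⟨h1, -⟩ | ⟨h1, -⟩ <;> have h2 := congrArg (Nat.cast : ℕ → F) h1 <;>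
      push_cast at h2 <;> rw [FiniteField.cast_card_eq_zero, h] at h2 <;> simp at h2
  have : NeZero (a : F) := ⟨haF⟩
  obtain ⟨ζ₀, hζ₀⟩ := HasEnoughRootsOfUnity.exists_primitiveRoot L a
  have key := Finset.card_mul_eq_card_mul
    (fun (M : SpecialLinearGroup (Fin 2) F) (ζ : L) => algebraMap F L M.1.trace = ζ + ζ⁻¹)
    (s := Finset.univ.filter fun M => orderOf M = a) (t := primitiveRoots a L) (m := 2)
    (n := 2 * b * Fintype.card F) ?_ ?_
  · rw [hζ₀.card_primitiveRoots] at key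
    rw [Nat.card_eq_fintype_card, Fintype.card_subtype]
    refine Nat.eq_of_mul_eq_mul_right two_pos (key.trans ?_)
    ring
  · intro M hM
    rw [Finset.mem_filter_univ] at hM
    obtain ⟨ζ, hζ, ht⟩ := exists_isPrimitiveRoot_trace_eq (L := L) ha ha3 haF M hM
    have h0 : ζ ≠ 0 := hζ.ne_zero (by omega)
    rw [Finset.card_eq_two]
    refine ⟨ζ, ζ⁻¹, hζ.ne_inv ha3, ?_⟩
    ext ξ
    rw [Finset.mem_bipartiteAbove, mem_primitiveRoots (by omega), Finset.mem_insert,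
      Finset.mem_singleton, ht]
    constructor
    · rintro ⟨hξ, h⟩
      have hξ0 : ξ ≠ 0 := hξ.ne_zero (by omega)
      have : (ξ - ζ) * (ξ - ζ⁻¹) = 0 := by
        linear_combination -ξ * h + mul_inv_cancel₀ h0 - mul_inv_cancel₀ hξ0
      exact (mul_eq_zero.1 this).imp sub_eq_zero.1 sub_eq_zero.1
    · rintro (rfl | rfl)
      · exact ⟨hζ, rfl⟩
      · exact ⟨hζ.inv, by rw [inv_inv, add_comm]⟩
  · intro ζ hζ
    rw [mem_primitiveRoots (by omega)] at hζ
    rw [← card_SL2_trace_eq_add_inv ha3 hab hζ, Nat.card_eq_fintype_card, Fintype.card_subtype]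
    congr 1
    ext M
    simp only [Finset.mem_bipartiteBelow, Finset.mem_filter_univ, and_iff_right_iff_imp]
    intro h
    rw [orderOf_SL2_eq_of_trace M (hζ.ne_zero (by omega)) (hζ.ne_inv ha3) h, hζ.eq_orderOf]

/-- In `H = PSL₂(𝔽_q)`, `q ≥ 5` an odd prime power, the number of cyclic
subgroups of cardinality `a` (the odd one of `(q-1)/2`, `(q+1)/2`) equals
`b * q`, where `b` is the other one. -/
theorem card_odd_tori_PSL2
    (p : ℕ) [Fact p.Prime] (hp : Odd p) (k : ℕ) (hk : 0 < k)
    (q : ℕ) (hq : q = p ^ k) (hq5 : 5 ≤ q)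
    (a b : ℕ) (hab : ({a, b} : Set ℕ) = {(q - 1) / 2, (q + 1) / 2}) (ha : Odd a) :
    Nat.card {T : Subgroup (PSL2 (GaloisField p k)) // IsCyclic T ∧ Nat.card T = a}
      = b * q := by
  classical
  have := Fintype.ofFinite (GaloisField p k)
  have hcard : Fintype.card (GaloisField p k) = q := by
    rw [← Nat.card_eq_fintype_card, GaloisField.card p k hk.ne', hq]
  have hab' : (q = 2 * a + 1 ∧ b = a + 1) ∨ (q + 1 = 2 * a ∧ b + 1 = a) := by
    obtain ⟨m, hm⟩ : Odd q := hq ▸ hp.pow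
    have := Set.pair_eq_pair_iff.1 hab
    omega
  have ha3 : 3 ≤ a := by
    obtain ⟨m, hm⟩ := ha
    omega
  have hZ : ∀ z ∈ Subgroup.center (SpecialLinearGroup (Fin 2) (GaloisField p k)), z ^ 2 = 1 := by
    intro z hz
    obtain ⟨r, hr, hrz⟩ := Matrix.SpecialLinearGroup.mem_center_iff.1 hz
    rw [SL2_pow_eq_one_iff, ← hrz, ← map_pow]
    rw [Fintype.card_fin] at hr
    rw [hr, map_one]
  refine Nat.eq_of_mul_eq_mul_right (Nat.totient_pos.2 (by omega : 0 < a)) ?_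
  rw [card_cyclic_subgroups_mul_totient, card_orderOf_eq_quotient_of_odd _ le_rfl hZ ha,
    card_orderOf_SL2 ha ha3 (by rwa [hcard]), hcard]
end

section
/- Let q ≥ 5 be an odd prime power, let H = PSL₂(𝔽_q), let a denote whichever of (q−1)/2 and (q+1)/2 is odd, and let T ≤ H be a cyclic subgroup of cardinality a. Then the number of ordered pairs (i, j) of involutions of H such that the product i·j lies in T and i·j ≠ 1 equals a·(a−1). -/
open Matrix

theorem card_sq_eq_mul_sq {F : Type*} [Field F] [Fintype F] [DecidableEq F]
    (hF : ringChar F ≠ 2) (D : F) :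
    (Nat.card {v : F × F // v.1 ^ 2 - D * v.2 ^ 2 = 0} : ℤ) =
      Fintype.card F + quadraticChar F D * (Fintype.card F - 1) := by
  have e : {v : F × F // v.1 ^ 2 - D * v.2 ^ 2 = 0} ≃ Σ w : F, {u : F // u ^ 2 = D * w ^ 2} :=
    { toFun := fun v ↦ ⟨v.1.2, v.1.1, sub_eq_zero.mp v.2⟩
      invFun := fun v ↦ ⟨(v.2.1, v.1), sub_eq_zero.mpr v.2.2⟩
      left_inv := fun _ ↦ rfl
      right_inv := fun _ ↦ rfl }
  have hfib (w : F) : (Nat.card {u : F // u ^ 2 = D * w ^ 2} : ℤ) =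
      1 + quadraticChar F D * if w = 0 then 0 else 1 := by
    have h := quadraticChar_card_sqrts hF (D * w ^ 2)
    rw [Set.toFinset_card, ← Nat.card_eq_fintype_card] at h
    refine h.trans ?_
    split_ifs with hw
    · simp [hw]
    · rw [map_mul, quadraticChar_sq_one' hw, add_comm]
  rw [Nat.card_congr e, Nat.card_sigma, Nat.cast_sum, Finset.sum_congr rfl fun w _ ↦ hfib w,
    Finset.sum_add_distrib, ← Finset.mul_sum, Finset.sum_ite]
  simp [Finset.filter_ne', Finset.card_erase_of_mem, Nat.cast_sub Fintype.card_pos]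

/-- Over a finite field of odd characteristic, the binary form `u² - D w²` represents every
nonzero element equally often. -/
theorem card_sq_sub_mul_sq_eq_one_eq {F : Type*} [Field F] [Fintype F]
    (hF : ringChar F ≠ 2) {D : F} (hD : D ≠ 0) {n : F} (hn : n ≠ 0) :
    Nat.card {v : F × F // v.1 ^ 2 - D * v.2 ^ 2 = n} =
      Nat.card {v : F × F // v.1 ^ 2 - D * v.2 ^ 2 = 1} := by
  obtain ⟨r, s, hrs⟩ : ∃ r s : F, r ^ 2 - D * s ^ 2 = n := by
    obtain ⟨r, s, h⟩ := FiniteField.exists_root_sum_quadratic (R := F)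
      (f := Polynomial.X ^ 2 - Polynomial.C n) (g := Polynomial.C (-D) * Polynomial.X ^ 2)
      (Polynomial.degree_X_pow_sub_C two_pos n)
      (Polynomial.degree_C_mul_X_pow 2 (neg_ne_zero.mpr hD))
      (FiniteField.odd_card_of_char_ne_two hF)
    exact ⟨r, s, by simp at h; linear_combination h⟩
  refine Nat.card_congr
    { toFun := fun v ↦ ⟨((v.1.1 * r - D * v.1.2 * s) / n, (v.1.2 * r - v.1.1 * s) / n), ?_⟩
      invFun := fun v ↦ ⟨(v.1.1 * r + D * v.1.2 * s, v.1.1 * s + v.1.2 * r), ?_⟩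
      left_inv := ?_
      right_inv := ?_ }
  · obtain ⟨⟨u, w⟩, h⟩ := v
    dsimp only at h ⊢
    field_simp
    linear_combination n * hrs + (r ^ 2 - D * s ^ 2) * h
  · obtain ⟨⟨u, w⟩, h⟩ := v
    dsimp only at h ⊢
    linear_combination hrs + (r ^ 2 - D * s ^ 2) * h
  · rintro ⟨⟨u, w⟩, h⟩
    ext
    · dsimp only
      field_simp
      linear_combination u * hrs
    · dsimp only
      field_simp
      linear_combination w * hrs
  · rintro ⟨⟨u, w⟩, h⟩
    ext
    · dsimp only
      field_simp
      linear_combination u * hrs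
    · dsimp only
      field_simp
      linear_combination w * hrs

theorem card_sq_sub_mul_sq {F : Type*} [Field F] [Fintype F] [DecidableEq F]
    (hF : ringChar F ≠ 2) {D : F} (hD : D ≠ 0) {n : F} (hn : n ≠ 0) :
    (Nat.card {v : F × F // v.1 ^ 2 - D * v.2 ^ 2 = n} : ℤ) =
      Fintype.card F - quadraticChar F D := by
  have htotal : ∑ m : F, (Nat.card {v : F × F // v.1 ^ 2 - D * v.2 ^ 2 = m} : ℤ) =
      (Fintype.card F : ℤ) ^ 2 := by
    rw [← Nat.cast_sum, ← Nat.card_sigma,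
      Nat.card_congr (Equiv.sigmaFiberEquiv fun v : F × F ↦ v.1 ^ 2 - D * v.2 ^ 2)]
    simp [sq]
  rw [← Finset.add_sum_erase _ _ (Finset.mem_univ 0), card_sq_eq_mul_sq hF,
    Finset.sum_congr rfl fun m hm ↦ congrArg Nat.cast
      ((card_sq_sub_mul_sq_eq_one_eq hF hD (Finset.ne_of_mem_erase hm)).trans
        (card_sq_sub_mul_sq_eq_one_eq hF hD hn).symm),
    Finset.sum_const, Finset.card_erase_of_mem (Finset.mem_univ _), Finset.card_univ,
    nsmul_eq_mul, Nat.cast_sub Fintype.card_pos] at htotal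
  have hcard : (1 : ℤ) < Fintype.card F := by exact_mod_cast Fintype.one_lt_card
  apply mul_left_cancel₀ (sub_ne_zero.mpr hcard.ne')
  push_cast at htotal
  linear_combination htotal

theorem Matrix.SpecialLinearGroup.mem_center_fin_two_iff_s10 {F : Type*} [Field F]
    (g : Matrix.SpecialLinearGroup (Fin 2) F) :
    g ∈ Subgroup.center (Matrix.SpecialLinearGroup (Fin 2) F) ↔
      g.1 0 1 = 0 ∧ g.1 1 0 = 0 ∧ g.1 0 0 = g.1 1 1 := by
  rw [Matrix.SpecialLinearGroup.mem_center_iff]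
  constructor
  · rintro ⟨r, -, hr⟩
    simp [← hr]
  · rintro ⟨h1, h2, h3⟩
    refine ⟨g.1 0 0, ?_, ?_⟩
    · have := g.2
      rw [det_fin_two, h1, ← h3] at this
      rw [Fintype.card_fin]
      linear_combination this
    · ext i j
      fin_cases i <;> fin_cases j <;> simp [h1, h2, h3]

theorem Matrix.SpecialLinearGroup.sq_eq_one_of_mem_center {F : Type*} [Field F]
    {g : Matrix.SpecialLinearGroup (Fin 2) F}
    (hg : g ∈ Subgroup.center (Matrix.SpecialLinearGroup (Fin 2) F)) : g ^ 2 = 1 := by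
  obtain ⟨r, hr, h⟩ := Matrix.SpecialLinearGroup.mem_center_iff.mp hg
  rw [Fintype.card_fin] at hr
  apply Subtype.ext
  rw [Matrix.SpecialLinearGroup.coe_pow, ← h, ← map_pow, hr, map_one,
    Matrix.SpecialLinearGroup.coe_one]

theorem Matrix.SpecialLinearGroup.card_center_fin_two_s10 {F : Type*} [Field F]
    (hF : ringChar F ≠ 2) :
    Nat.card (Subgroup.center (Matrix.SpecialLinearGroup (Fin 2) F)) = 2 := by
  rw [Nat.card_congr Matrix.SpecialLinearGroup.center_equiv_rootsOfUnity.toEquiv]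
  exact (IsPrimitiveRoot.neg_one (R := F) (ringChar F) hF).card_rootsOfUnity

/-- The involutions of `PSL₂` are the classes of the trace zero matrices. -/
theorem PSL2.mk_isInvolution_iff {F : Type*} [Field F] (hF : ringChar F ≠ 2)
    (g : Matrix.SpecialLinearGroup (Fin 2) F) :
    ((g : PSL2 F) ^ 2 = 1 ∧ (g : PSL2 F) ≠ 1) ↔ g.1.trace = 0 := by
  rw [← QuotientGroup.mk_pow, ne_eq, QuotientGroup.eq_one_iff, QuotientGroup.eq_one_iff,
    Matrix.SpecialLinearGroup.mem_center_fin_two_iff_s10,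
    Matrix.SpecialLinearGroup.mem_center_fin_two_iff_s10]
  have hdet := g.2
  rw [det_fin_two] at hdet
  simp only [sq, Matrix.SpecialLinearGroup.coe_mul, mul_apply, Fin.sum_univ_two, trace_fin_two]
  constructor
  · rintro ⟨⟨h1, h2, h3⟩, h⟩
    by_contra ht
    exact h ⟨mul_left_cancel₀ ht (by linear_combination h1),
      mul_left_cancel₀ ht (by linear_combination h2),
      mul_left_cancel₀ ht (by linear_combination h3)⟩
  · intro ht
    refine ⟨⟨by linear_combination g.1 0 1 * ht, by linear_combination g.1 1 0 * ht,
      by linear_combination (g.1 0 0 - g.1 1 1) * ht⟩, fun ⟨h1, h2, h3⟩ ↦ ?_⟩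
    have h0 : g.1 1 1 = 0 := by
      apply mul_left_cancel₀ (Ring.two_ne_zero hF)
      linear_combination ht - h3
    rw [h1, h0] at hdet
    simp at hdet

theorem card_conic_of_ne_zero {F : Type*} [Field F] [Fintype F] [DecidableEq F]
    (hF : ringChar F ≠ 2) {e β γ : F} (hγ : γ ≠ 0) (hD : e ^ 2 + 4 * (β * γ) ≠ 0) :
    (Nat.card {v : F × F × F // v.1 ^ 2 + v.2.1 * v.2.2 = -1 ∧
        v.1 * e + v.2.1 * γ + v.2.2 * β = 0} : ℤ) =
      Fintype.card F - quadraticChar F (e ^ 2 + 4 * (β * γ)) := by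
  have h2 := Ring.two_ne_zero hF
  rw [← card_sq_sub_mul_sq hF hD (neg_ne_zero.mpr one_ne_zero)]
  congr 1
  refine Nat.card_congr
    { toFun := fun v ↦ ⟨(v.1.1 - e * v.1.2.2 / (2 * γ), v.1.2.2 / (2 * γ)), ?_⟩
      invFun := fun v ↦ ⟨(v.1.1 + e * v.1.2,
        -((v.1.1 + e * v.1.2) * e + 2 * γ * v.1.2 * β) / γ, 2 * γ * v.1.2), ?_, ?_⟩
      left_inv := ?_
      right_inv := ?_ }
  · obtain ⟨⟨x, y, z⟩, h, h'⟩ := v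
    dsimp only at h h' ⊢
    field_simp
    linear_combination 4 * γ ^ 2 * h - 4 * γ * z * h'
  · obtain ⟨⟨u, w⟩, h⟩ := v
    dsimp only at h ⊢
    field_simp
    linear_combination h
  · dsimp only
    field_simp
    ring
  · rintro ⟨⟨x, y, z⟩, h, h'⟩
    ext
    · dsimp only
      field_simp
      ring
    · dsimp only
      field_simp
      linear_combination -2 * γ * h'
    · dsimp only
      field_simp
  · rintro ⟨⟨u, w⟩, h⟩
    ext
    · dsimp only
      field_simp
      ring
    · dsimp only
      field_simp

theorem card_conic {F : Type*} [Field F] [Fintype F] [DecidableEq F]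
    (hF : ringChar F ≠ 2) {e β γ : F} (hD : e ^ 2 + 4 * (β * γ) ≠ 0) :
    (Nat.card {v : F × F × F // v.1 ^ 2 + v.2.1 * v.2.2 = -1 ∧
        v.1 * e + v.2.1 * γ + v.2.2 * β = 0} : ℤ) =
      Fintype.card F - quadraticChar F (e ^ 2 + 4 * (β * γ)) := by
  have h2 := Ring.two_ne_zero hF
  by_cases hγ : γ = 0
  swap
  · exact card_conic_of_ne_zero hF hγ hD
  by_cases hβ : β = 0
  swap
  · rw [mul_comm β] at hD ⊢
    rw [← card_conic_of_ne_zero hF hβ hD]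
    congr 1
    refine Nat.card_congr (((Equiv.refl F).prodCongr (Equiv.prodComm F F)).subtypeEquiv ?_)
    rintro ⟨x, y, z⟩
    simp [mul_comm, add_right_comm]
  subst hγ hβ
  rw [← card_sq_sub_mul_sq hF hD (neg_ne_zero.mpr one_ne_zero)]
  have he : e ≠ 0 := by rintro rfl; simp at hD
  congr 1
  refine Nat.card_congr
    { toFun := fun v ↦ ⟨((v.1.2.1 + v.1.2.2) / 2, (v.1.2.1 - v.1.2.2) / (2 * e)), ?_⟩
      invFun := fun v ↦ ⟨(0, v.1.1 + e * v.1.2, v.1.1 - e * v.1.2), ?_, ?_⟩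
      left_inv := ?_
      right_inv := ?_ }
  · obtain ⟨⟨x, y, z⟩, h, h'⟩ := v
    obtain rfl : x = 0 := by simpa [he] using h'
    dsimp only at h ⊢
    field_simp
    linear_combination 4 * e ^ 2 * h
  · obtain ⟨⟨u, w⟩, h⟩ := v
    dsimp only at h ⊢
    linear_combination h
  · simp
  · rintro ⟨⟨x, y, z⟩, h, h'⟩
    obtain rfl : x = 0 := by simpa [he] using h'
    ext
    · rfl
    · dsimp only
      field_simp
      ring
    · dsimp only
      field_simp
      ring
  · rintro ⟨⟨u, w⟩, h⟩
    ext
    · dsimp only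
      field_simp
      ring
    · dsimp only
      field_simp
      ring

theorem Matrix.SpecialLinearGroup.card_trace_eq_zero_trace_mul_eq_zero {F : Type*} [Field F]
    [Fintype F] [DecidableEq F] (hF : ringChar F ≠ 2) (S : Matrix.SpecialLinearGroup (Fin 2) F)
    (hD : S.1.trace ^ 2 - 4 ≠ 0) :
    (Nat.card {g : Matrix.SpecialLinearGroup (Fin 2) F //
        g.1.trace = 0 ∧ (g * S).1.trace = 0} : ℤ) =
      Fintype.card F - quadraticChar F (S.1.trace ^ 2 - 4) := by
  have hdet := S.2
  rw [det_fin_two] at hdet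
  have hdisc : S.1.trace ^ 2 - 4 = (S.1 0 0 - S.1 1 1) ^ 2 + 4 * (S.1 0 1 * S.1 1 0) := by
    rw [trace_fin_two]
    linear_combination 4 * hdet
  rw [hdisc] at hD ⊢
  rw [← card_conic hF hD]
  congr 1
  refine Nat.card_congr
    { toFun := fun g ↦ ⟨(g.1.1 0 0, g.1.1 0 1, g.1.1 1 0), ?_, ?_⟩
      invFun := fun v ↦ ⟨⟨!![v.1.1, v.1.2.1; v.1.2.2, -v.1.1], ?_⟩, ?_, ?_⟩
      left_inv := ?_
      right_inv := fun _ ↦ rfl }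
  · obtain ⟨g, ht, -⟩ := g
    have hg := g.2
    rw [det_fin_two] at hg
    rw [trace_fin_two] at ht
    linear_combination g.1 0 0 * ht - hg
  · obtain ⟨g, ht, ht'⟩ := g
    simp only [Matrix.SpecialLinearGroup.coe_mul, trace_fin_two, mul_apply,
      Fin.sum_univ_two] at ht ht'
    linear_combination ht' - S.1 1 1 * ht
  · rw [det_fin_two_of]
    linear_combination -v.2.1
  · simp [trace_fin_two]
  · change (!![v.1.1, v.1.2.1; v.1.2.2, -v.1.1] * S.1).trace = 0
    simp only [trace_fin_two, mul_apply, Fin.sum_univ_two, of_apply, cons_val]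
    linear_combination v.2.2
  · rintro ⟨g, ht, ht'⟩
    rw [trace_fin_two] at ht
    ext i j
    fin_cases i <;> fin_cases j <;> simp [eq_neg_of_add_eq_zero_right ht]

theorem QuotientGroup.card_subtype_mk {G : Type*} [Group G] (N : Subgroup G) (P : G ⧸ N → Prop) :
    Nat.card {g : G // P g} = Nat.card N * Nat.card {x : G ⧸ N // P x} := by
  rw [← Nat.card_prod]
  exact Nat.card_congr (QuotientGroup.preimageMkEquivSubgroupProdSet N {x | P x})

/-- The Frobenius power of a 2×2 matrix. -/
theorem Matrix.two_smul_pow_card_fin_two {F : Type*} [Field F] [Fintype F] [DecidableEq F]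
    (hF : ringChar F ≠ 2) (M : Matrix (Fin 2) (Fin 2) F) :
    (2 : F) • M ^ Fintype.card F =
      (quadraticChar F (M.trace ^ 2 - 4 * M.det) : F) • ((2 : F) • M - M.trace • 1) +
        M.trace • 1 := by
  obtain ⟨n, hp, hn⟩ := FiniteField.card F (ringChar F)
  have : Fact (ringChar F).Prime := ⟨hp⟩
  set q := Fintype.card F with hq
  set R := (2 : F) • M - M.trace • 1 with hR
  have hRsq : R ^ 2 = (M.trace ^ 2 - 4 * M.det) • 1 := by
    ext i j
    fin_cases i <;> fin_cases j <;>
      simp [hR, sq, mul_apply, trace_fin_two, det_fin_two, Fin.sum_univ_two] <;> ring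
  have hRq : R ^ q = (quadraticChar F (M.trace ^ 2 - 4 * M.det) : F) • R := by
    rw [quadraticChar_eq_pow_of_char_ne_two' hF, ← hq]
    have hodd := FiniteField.odd_card_of_char_ne_two hF
    conv_lhs => rw [show q = 2 * (q / 2) + 1 by omega, pow_succ, pow_mul, hRsq]
    rw [smul_pow, one_pow, smul_mul_assoc, one_mul]
  have hM : (2 : F) • M = R + M.trace • 1 := by simp [hR]
  have h2 : (2 : F) • M ^ q = ((2 : F) • M) ^ q := by
    rw [smul_pow, FiniteField.pow_card]
  have hcomm : Commute R (M.trace • 1) := (Commute.one_right R).smul_right _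
  rw [h2, hM, hn, add_pow_char_pow_of_commute _ _ hcomm, ← hn, hRq, smul_pow, one_pow,
    FiniteField.pow_card]

theorem Matrix.SpecialLinearGroup.quadraticChar_discr_of_pow_mem_center {F : Type*} [Field F]
    [Fintype F] [DecidableEq F] (hF : ringChar F ≠ 2) {S : Matrix.SpecialLinearGroup (Fin 2) F}
    (hS : S ^ 2 ∉ Subgroup.center (Matrix.SpecialLinearGroup (Fin 2) F)) {a : ℕ}
    (hSa : S ^ a ∈ Subgroup.center (Matrix.SpecialLinearGroup (Fin 2) F)) {ε : ℤ}
    (hε : ε = 1 ∨ ε = -1) (ha : (2 * a : ℤ) = Fintype.card F - ε) :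
    quadraticChar F (S.1.trace ^ 2 - 4) = ε := by
  have h2 := Ring.two_ne_zero hF
  have hfrob := two_smul_pow_card_fin_two hF S.1
  rw [S.2, mul_one] at hfrob
  have hS2a : S ^ (2 * a) = 1 := by
    rw [mul_comm, pow_mul, sq_eq_one_of_mem_center hSa]
  have hSq : S ^ Fintype.card F = S ^ ε := by
    rw [← zpow_natCast, show (Fintype.card F : ℤ) = (2 * a : ℕ) + ε by push_cast; omega,
      _root_.zpow_add, zpow_natCast, hS2a, one_mul]
  have hne : S ≠ S⁻¹ := fun h ↦ hS (by
    rw [sq, mul_eq_one_iff_eq_inv.mpr h]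
    exact one_mem _)
  have hinv : (S⁻¹).1 = S.1.trace • 1 - S.1 := by
    rw [Matrix.SpecialLinearGroup.coe_inv, adjugate_fin_two]
    ext i j
    fin_cases i <;> fin_cases j <;> simp [trace_fin_two]
  rw [← coe_pow, hSq] at hfrob
  rcases eq_or_ne (S.1.trace ^ 2 - 4) 0 with hD | hD
  · exfalso
    rw [hD, MulChar.map_zero, Int.cast_zero, zero_smul, zero_add] at hfrob
    have hcen : S ^ ε ∈ Subgroup.center (Matrix.SpecialLinearGroup (Fin 2) F) := by
      have key (i j) : 2 * (S ^ ε).1 i j = S.1.trace * (1 : Matrix (Fin 2) (Fin 2) F) i j :=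
        congrFun (congrFun hfrob i) j
      rw [mem_center_fin_two_iff_s10]
      refine ⟨mul_left_cancel₀ h2 ?_, mul_left_cancel₀ h2 ?_, mul_left_cancel₀ h2 ?_⟩ <;>
        simp [key]
    rcases hε with rfl | rfl
    · exact hS (pow_mem (by simpa using hcen) 2)
    · exact hS (pow_mem (by simpa using hcen) 2)
  · have hcancel {A B : Matrix.SpecialLinearGroup (Fin 2) F} (h : (2 : F) • A.1 = (2 : F) • B.1) :
        A = B := Subtype.ext (smul_right_injective _ h2 h)
    rcases quadraticChar_dichotomy hD with h | h <;> rcases hε with rfl | rfl <;>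
      rw [h] at hfrob ⊢ <;> exfalso <;> apply hne
    · refine (hcancel ?_).symm
      rw [_root_.zpow_neg_one] at hfrob
      rw [hfrob]
      simp
    · apply hcancel
      rw [zpow_one] at hfrob
      rw [hfrob, hinv]
      simp only [Int.reduceNeg, Int.cast_neg, Int.cast_one]
      module

theorem PSL2.card_involution_mul_involution {F : Type*} [Field F] [Fintype F]
    (hF : ringChar F ≠ 2) {s : PSL2 F} (hs : s ^ 2 ≠ 1) {a : ℕ} (hsa : s ^ a = 1)
    {ε : ℤ} (hε : ε = 1 ∨ ε = -1) (ha : (2 * a : ℤ) = Fintype.card F - ε) :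
    Nat.card {i : PSL2 F // (i ^ 2 = 1 ∧ i ≠ 1) ∧ (i * s) ^ 2 = 1 ∧ i * s ≠ 1} = a := by
  classical
  obtain ⟨S, rfl⟩ := QuotientGroup.mk_surjective s
  rw [← QuotientGroup.mk_pow, ne_eq, QuotientGroup.eq_one_iff] at hs
  rw [← QuotientGroup.mk_pow, QuotientGroup.eq_one_iff] at hsa
  have hχ := Matrix.SpecialLinearGroup.quadraticChar_discr_of_pow_mem_center hF hs hsa hε ha
  have hD : S.1.trace ^ 2 - 4 ≠ 0 := by
    intro h
    rw [h, MulChar.map_zero] at hχ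
    omega
  have hcount := Matrix.SpecialLinearGroup.card_trace_eq_zero_trace_mul_eq_zero hF S hD
  have hquot : Nat.card {g : Matrix.SpecialLinearGroup (Fin 2) F //
      g.1.trace = 0 ∧ (g * S).1.trace = 0} =
      2 * Nat.card {i : PSL2 F // (i ^ 2 = 1 ∧ i ≠ 1) ∧
        (i * (S : PSL2 F)) ^ 2 = 1 ∧ i * (S : PSL2 F) ≠ 1} := by
    refine (Nat.card_congr (Equiv.subtypeEquivRight fun g ↦ ?_)).trans
      ((QuotientGroup.card_subtype_mk _ _).trans
        (congrArg (· * _) (Matrix.SpecialLinearGroup.card_center_fin_two_s10 hF)))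
    exact ((mk_isInvolution_iff hF g).and (mk_isInvolution_iff hF (g * S))).symm
  rw [hquot, hχ] at hcount
  push_cast at hcount
  omega

theorem card_involution_pairs_mul_mem {G : Type*} [Group G] [Finite G] (T : Subgroup G) {a : ℕ}
    (hT : Nat.card T = a)
    (h : ∀ s ∈ T, s ≠ 1 →
      Nat.card {i : G // (i ^ 2 = 1 ∧ i ≠ 1) ∧ (i * s) ^ 2 = 1 ∧ i * s ≠ 1} = a) :
    Nat.card {ij : G × G // (ij.1 ^ 2 = 1 ∧ ij.1 ≠ 1) ∧ (ij.2 ^ 2 = 1 ∧ ij.2 ≠ 1) ∧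
      ij.1 * ij.2 ∈ T ∧ ij.1 * ij.2 ≠ 1} = a * (a - 1) := by
  classical
  have := Fintype.ofFinite G
  have hmul {i j : G} (hi : i ^ 2 = 1) : i * (i * j) = j := by
    rw [← mul_assoc, ← sq, hi, one_mul]
  let e : {ij : G × G // (ij.1 ^ 2 = 1 ∧ ij.1 ≠ 1) ∧ (ij.2 ^ 2 = 1 ∧ ij.2 ≠ 1) ∧
      ij.1 * ij.2 ∈ T ∧ ij.1 * ij.2 ≠ 1} ≃
      Σ s : {s : T // s ≠ 1},
        {i : G // (i ^ 2 = 1 ∧ i ≠ 1) ∧ (i * s.1.1) ^ 2 = 1 ∧ i * s.1.1 ≠ 1} :=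
    { toFun := fun x ↦ ⟨⟨⟨x.1.1 * x.1.2, x.2.2.2.1⟩,
          fun hx ↦ x.2.2.2.2 (congrArg Subtype.val hx)⟩,
        x.1.1, x.2.1, by simpa only [hmul x.2.1.1] using x.2.2.1⟩
      invFun := fun x ↦ ⟨(x.2.1, x.2.1 * x.1.1.1), x.2.2.1, x.2.2.2, by
        simpa only [hmul x.2.2.1.1] using
          ⟨x.1.1.2, fun hx ↦ x.1.2 (Subtype.ext hx)⟩⟩
      left_inv := fun x ↦ Subtype.ext (Prod.ext rfl (hmul x.2.1.1))
      right_inv := by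
        rintro ⟨⟨⟨s, hs⟩, hs1⟩, i, hi, hi'⟩
        have hs' := hmul (j := s) hi.1
        refine Sigma.ext (Subtype.ext (Subtype.ext hs')) ?_
        dsimp only
        congr! 4 <;> simp only [hs'] }
  rw [Nat.card_congr e, Nat.card_sigma,
    Finset.sum_congr rfl fun s _ ↦ h s.1.1 s.1.2 fun hs ↦ s.2 (Subtype.ext hs),
    Finset.sum_const, Finset.card_univ, smul_eq_mul, mul_comm, Fintype.card_subtype_compl,
    Fintype.card_subtype_eq, ← Nat.card_eq_fintype_card, hT]

/-- In `H = PSL₂(𝔽_q)`, `q ≥ 5` an odd prime power, and `T` a cyclic subgroup of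
odd cardinality `a ∈ {(q-1)/2, (q+1)/2}`, the number of ordered pairs of
involutions `(i, j)` with `i * j` a nontrivial element of `T` is `a * (a - 1)`. -/
theorem card_involution_pairs_in_torus_PSL2
    (p : ℕ) [Fact p.Prime] (hp : Odd p) (k : ℕ) (hk : 0 < k)
    (q : ℕ) (hq : q = p ^ k) (hq5 : 5 ≤ q)
    (a : ℕ) (ha : (a = (q - 1) / 2 ∨ a = (q + 1) / 2) ∧ Odd a)
    (T : Subgroup (PSL2 (GaloisField p k))) (hTcyc : IsCyclic T)
    (hTcard : Nat.card T = a) :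
    Nat.card {ij : PSL2 (GaloisField p k) × PSL2 (GaloisField p k) //
        (ij.1 ^ 2 = 1 ∧ ij.1 ≠ 1) ∧ (ij.2 ^ 2 = 1 ∧ ij.2 ≠ 1) ∧
        ij.1 * ij.2 ∈ T ∧ ij.1 * ij.2 ≠ 1}
      = a * (a - 1) := by
  have := Fintype.ofFinite (GaloisField p k)
  have hcard : Fintype.card (GaloisField p k) = q := by
    rw [← Nat.card_eq_fintype_card, GaloisField.card p k hk.ne', hq]
  have hF : ringChar (GaloisField p k) ≠ 2 := by
    rw [ringChar.eq (GaloisField p k) p]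
    rintro rfl
    exact absurd hp (by decide)
  have hqodd : q % 2 = 1 := Nat.odd_iff.mp (hq ▸ hp.pow)
  have : Finite (Matrix.SpecialLinearGroup (Fin 2) (GaloisField p k)) := Subtype.finite
  refine card_involution_pairs_mul_mem T hTcard fun s hs hs1 ↦ ?_
  have hsa : s ^ a = 1 := by
    rw [← hTcard]
    exact congrArg Subtype.val (pow_card_eq_one' (x := (⟨s, hs⟩ : T)))
  have hs2 : s ^ 2 ≠ 1 := fun h ↦ hs1 (by
    have := pow_gcd_eq_one.mpr ⟨h, hsa⟩
    rwa [Nat.coprime_two_left.mpr ha.2, pow_one] at this)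
  rcases ha.1 with h | h
  · exact PSL2.card_involution_mul_involution hF hs2 hsa (Or.inl rfl) (by omega)
  · exact PSL2.card_involution_mul_involution hF hs2 hsa (Or.inr rfl) (by omega)
end

section
/- Let q ≥ 5 be an odd prime power, let H = PSL₂(𝔽_q), and let N be the number of involutions of H. Then the number of ordered pairs (i, j) of involutions of H such that the product i·j has odd order is at least (1/2 − 1/(2q))·N²; equivalently, 2q times the number of such pairs is at least (q−1)·N². -/
open Matrix

open scoped MatrixGroups

namespace PSL2

variable {F : Type*} [Field F]

theorem mem_center_iff_eq_one_or_neg_one (A : SL(2, F)) :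
    A ∈ Subgroup.center SL(2, F) ↔ A = 1 ∨ A = -1 := by
  constructor
  · rw [Matrix.SpecialLinearGroup.mem_center_iff]
    rintro ⟨r, hr, hA⟩
    rw [Fintype.card_fin, sq_eq_one_iff] at hr
    rcases hr with rfl | rfl
    · left; ext1 i j; rw [← hA]; simp
    · right; apply Subtype.ext; rw [← hA, map_neg, map_one]; simp
  · rintro (rfl | rfl)
    · exact one_mem _
    · rw [Subgroup.mem_center_iff]
      intro g
      simp

theorem coe_eq_coe_iff (A B : SL(2, F)) : (A : PSL2 F) = B ↔ B = A ∨ B = -A := by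
  rw [QuotientGroup.eq, mem_center_iff_eq_one_or_neg_one, inv_mul_eq_iff_eq_mul,
    inv_mul_eq_iff_eq_mul]
  simp

theorem coe_eq_one_iff (A : SL(2, F)) : (A : PSL2 F) = 1 ↔ A = 1 ∨ A = -1 := by
  rw [QuotientGroup.eq_one_iff, mem_center_iff_eq_one_or_neg_one]

theorem entries_det (A : SL(2, F)) :
    A.1 0 0 * A.1 1 1 - A.1 0 1 * A.1 1 0 = 1 := by
  rw [← det_fin_two]
  exact A.2

theorem coe_isInvolution_iff (h2 : (2 : F) ≠ 0) (A : SL(2, F)) :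
    ((A : PSL2 F) ^ 2 = 1 ∧ (A : PSL2 F) ≠ 1) ↔ A.1.trace = 0 := by
  have hd := entries_det A
  have hsq : ((A ^ 2 : SL(2, F)) : PSL2 F) = (A : PSL2 F) ^ 2 := rfl
  rw [← hsq, ne_eq, coe_eq_one_iff, coe_eq_one_iff, trace_fin_two]
  simp only [Matrix.SpecialLinearGroup.ext_iff, Fin.forall_fin_two, sq,
    Matrix.SpecialLinearGroup.coe_mul, mul_apply, Fin.sum_univ_two,
    Matrix.SpecialLinearGroup.coe_neg, Matrix.SpecialLinearGroup.coe_one,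
    Matrix.neg_apply, one_apply_eq, ne_eq, zero_ne_one, one_ne_zero, not_false_eq_true,
    one_apply_ne, neg_zero]
  generalize A.1 0 0 = a at *
  generalize A.1 0 1 = b at *
  generalize A.1 1 0 = c at *
  generalize A.1 1 1 = d at *
  constructor
  · rintro ⟨h, hn⟩
    by_contra ht
    have hb : b = 0 := by
      have : b * (a + d) = 0 := by
        rcases h with h | h <;> linear_combination h.1.2
      simpa [ht] using this
    have hc : c = 0 := by
      have : c * (a + d) = 0 := by
        rcases h with h | h <;> linear_combination h.2.1
      simpa [ht] using this
    subst hb hc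
    have had : a = d := by
      have : (a - d) * (a + d) = 0 := by
        rcases h with h | h <;> linear_combination h.1.1 - h.2.2
      exact sub_eq_zero.1 (by simpa [ht] using this)
    subst had
    have : a ^ 2 = 1 := by linear_combination hd
    rcases sq_eq_one_iff.1 this with rfl | rfl <;> simp at hn
  · intro ht
    obtain rfl : d = -a := by linear_combination ht
    refine ⟨Or.inr ⟨⟨?_, ?_⟩, ?_, ?_⟩, ?_⟩
    · linear_combination -hd
    · ring
    · ring
    · linear_combination -hd
    · rintro (⟨⟨rfl, _⟩, _, h⟩ | ⟨⟨rfl, _⟩, _, h⟩) <;> apply h2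
      · linear_combination -h
      · linear_combination h

/-- The centralizer of a traceless `Z` of determinant one consists of the elements `a + b Z`. -/
theorem exists_eq_smul_add_smul_of_commute (h2 : (2 : F) ≠ 0) {X Z : SL(2, F)}
    (hZ : Z.1.trace = 0) (hXZ : X * Z = Z * X) :
    ∃ a b : F, a ^ 2 + b ^ 2 = 1 ∧ X.1 = a • 1 + b • Z.1 := by
  have hdX := entries_det X
  have hdZ := entries_det Z
  simp only [Matrix.SpecialLinearGroup.ext_iff, Fin.forall_fin_two,
    Matrix.SpecialLinearGroup.coe_mul, mul_apply, Fin.sum_univ_two] at hXZ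
  obtain ⟨⟨h00, h01⟩, h10, h11⟩ := hXZ
  rw [trace_fin_two] at hZ
  suffices h : ∃ a b : F, X.1 0 0 = a + b * Z.1 0 0 ∧ X.1 0 1 = b * Z.1 0 1 ∧
      X.1 1 0 = b * Z.1 1 0 ∧ X.1 1 1 = a + b * Z.1 1 1 by
    obtain ⟨a, b, e00, e01, e10, e11⟩ := h
    refine ⟨a, b, ?_, ?_⟩
    · rw [e00, e01, e10, e11] at hdX
      linear_combination hdX - b ^ 2 * hdZ - a * b * hZ
    · ext i j
      fin_cases i <;> fin_cases j <;> simp [e00, e01, e10, e11]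
  generalize X.1 0 0 = x at *
  generalize X.1 0 1 = y at *
  generalize X.1 1 0 = w at *
  generalize X.1 1 1 = s at *
  generalize Z.1 0 0 = z at *
  generalize Z.1 0 1 = u at *
  generalize Z.1 1 0 = v at *
  generalize Z.1 1 1 = z' at *
  obtain rfl : z' = -z := by linear_combination hZ
  refine ⟨(x + s) / 2, -(x * z + y * v + w * u - s * z) / 2, ?_, ?_, ?_, ?_⟩ <;> field_simp
  · linear_combination (s - x) * hdZ - v * h01 - z * h00
  · linear_combination -2 * y * hdZ - u * h00 + z * h01
  · linear_combination -2 * w * hdZ + v * h00 - z * h10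
  · linear_combination (x - s) * hdZ + v * h01 + z * h00

theorem mul_eq_neg_mul_of_trace {A Z : Matrix (Fin 2) (Fin 2) F}
    (hA : A.trace = 0) (hZ : Z.trace = 0) (hAZ : (A * Z).trace = 0) : A * Z = -(Z * A) := by
  rw [trace_fin_two] at *
  simp only [mul_apply, Fin.sum_univ_two] at hAZ
  have hA' : A 1 1 = -A 0 0 := by linear_combination hA
  have hZ' : Z 1 1 = -Z 0 0 := by linear_combination hZ
  rw [hA', hZ'] at hAZ
  ext i j
  fin_cases i <;> fin_cases j <;>
    simp only [Fin.zero_eta, Fin.mk_one, mul_apply, Fin.sum_univ_two, Matrix.neg_apply, hA', hZ']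
  · linear_combination hAZ
  · ring
  · ring
  · linear_combination hAZ

theorem mul_self_of_trace_eq_zero {A : SL(2, F)} (hA : A.1.trace = 0) : A * A = -1 := by
  have hd := entries_det A
  rw [trace_fin_two] at hA
  have hA' : A.1 1 1 = -A.1 0 0 := by linear_combination hA
  rw [hA'] at hd
  ext i j
  fin_cases i <;> fin_cases j <;>
    simp [mul_apply, Fin.sum_univ_two, hA']
  · linear_combination -hd
  · ring
  · ring
  · linear_combination -hd

theorem exists_of_not_odd_orderOf_mul [Finite F] (h2 : (2 : F) ≠ 0) {A B : SL(2, F)}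
    (hA : A.1.trace = 0) (hB : B.1.trace = 0)
    (hodd : ¬ Odd (orderOf ((A : PSL2 F) * (B : PSL2 F)))) :
    ∃ (Z : SL(2, F)) (a b : F), (Z.1.trace = 0 ∧ (A.1 * Z.1).trace = 0) ∧
      (a ^ 2 + b ^ 2 = 1 ∧ b ≠ 0) ∧ (A * B).1 = a • 1 + b • Z.1 := by
  set h : PSL2 F := (A : PSL2 F) * (B : PSL2 F) with hh
  have hAB : ((A * B : SL(2, F)) : PSL2 F) = h := rfl
  obtain ⟨n, hn⟩ := Nat.not_odd_iff_even.1 hodd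
  have hpos : 0 < orderOf h := orderOf_pos h
  have hpow : (((A * B) ^ n : SL(2, F)) : PSL2 F) = h ^ n := rfl
  have hZ : ((A * B) ^ n : SL(2, F)).1.trace = 0 := by
    rw [← coe_isInvolution_iff h2, hpow, ← pow_mul, mul_two, ← hn]
    exact ⟨pow_orderOf_eq_one h, pow_ne_one_of_lt_orderOf (by omega) (by omega)⟩
  generalize hZdef : (A * B) ^ n = Z at hZ
  have hcomm : A * B * Z = Z * (A * B) := by
    rw [← hZdef]
    exact (Commute.self_pow _ _).eq
  obtain ⟨a, b, hab, hX⟩ := exists_eq_smul_add_smul_of_commute h2 hZ hcomm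
  have hb : b ≠ 0 := by
    rintro rfl
    have h1 : h = 1 := by
      rw [← hAB, coe_eq_one_iff]
      have ha : a ^ 2 = 1 := by simpa using hab
      rcases sq_eq_one_iff.1 ha with rfl | rfl
      · left; ext1 i j; simp [hX]
      · right; ext1 i j; rw [hX]; simp
    rw [h1, orderOf_one] at hn
    omega
  refine ⟨Z, a, b, ⟨hZ, ?_⟩, ⟨hab, hb⟩, hX⟩
  have h1 : A.1 * (A * B).1 = -B.1 := by
    have := mul_self_of_trace_eq_zero hA
    rw [← Matrix.SpecialLinearGroup.coe_mul, ← mul_assoc, this]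
    simp
  rw [hX, mul_add, mul_smul_comm, mul_smul_comm, mul_one] at h1
  have h3 := congrArg Matrix.trace h1
  rw [trace_add, trace_smul, trace_smul, trace_neg, hA, hB] at h3
  simpa [hb] using h3

section Counting

variable [Fintype F] [DecidableEq F]

theorem card_circle_ne_zero_le (h2 : (2 : F) ≠ 0) :
    (Finset.univ.filter fun v : F × F => v.1 ^ 2 + v.2 ^ 2 = 1 ∧ v.2 ≠ 0).card ≤
      Fintype.card F - 1 := by
  rw [← Finset.card_univ, ← Finset.card_erase_of_mem (Finset.mem_univ (0 : F))]
  have aux : ∀ v : F × F, v.1 ^ 2 + v.2 ^ 2 = 1 ∧ v.2 ≠ 0 → v.1 - 1 ≠ 0 := by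
    rintro ⟨a, b⟩ ⟨h, hb⟩ ha
    obtain rfl : a = 1 := sub_eq_zero.1 ha
    exact hb (by simpa using h)
  refine Finset.card_le_card_of_injOn (fun v => v.2 / (v.1 - 1)) ?_ ?_
  · intro v hv
    have hv' : v.1 ^ 2 + v.2 ^ 2 = 1 ∧ v.2 ≠ 0 := by simpa using hv
    simp [hv'.2, aux v hv']
  · intro v hv w hw hvw
    have hv' : v.1 ^ 2 + v.2 ^ 2 = 1 ∧ v.2 ≠ 0 := by simpa using hv
    have hw' : w.1 ^ 2 + w.2 ^ 2 = 1 ∧ w.2 ≠ 0 := by simpa using hw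
    have hav := aux v hv'
    have haw := aux w hw'
    obtain ⟨a, b⟩ := v
    obtain ⟨c, d⟩ := w
    simp only at *
    obtain ⟨s, hs⟩ : ∃ s, s = b / (a - 1) := ⟨_, rfl⟩
    have hb : b = s * (a - 1) := by rw [hs]; field_simp
    have hd : d = s * (c - 1) := by rw [hs, hvw]; field_simp
    have ea : (1 + s ^ 2) * a = s ^ 2 - 1 := by
      apply mul_left_cancel₀ hav
      have := hv'.1
      rw [hb] at this
      linear_combination this
    have ec : (1 + s ^ 2) * c = s ^ 2 - 1 := by
      apply mul_left_cancel₀ haw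
      have := hw'.1
      rw [hd] at this
      linear_combination this
    have hs1 : 1 + s ^ 2 ≠ 0 := by
      intro h0
      apply h2
      linear_combination (1 - a) * h0 + ea
    have hac : a = c := mul_left_cancel₀ hs1 (ea.trans ec.symm)
    rw [hb, hd, hac]

theorem card_circle_le (h2 : (2 : F) ≠ 0) :
    (Finset.univ.filter fun v : F × F => v.1 ^ 2 + v.2 ^ 2 = 1).card ≤ Fintype.card F + 1 := by
  have hsub : (Finset.univ.filter fun v : F × F => v.1 ^ 2 + v.2 ^ 2 = 1) ⊆
      (Finset.univ.filter fun v : F × F => v.1 ^ 2 + v.2 ^ 2 = 1 ∧ v.2 ≠ 0) ∪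
        {(1, 0), (-1, 0)} := by
    rintro ⟨a, b⟩ h
    by_cases hb : b = 0
    · subst hb
      have h1 : a ^ 2 = 1 := by simpa using h
      rcases sq_eq_one_iff.1 h1 with rfl | rfl <;> simp
    · have h1 : a ^ 2 + b ^ 2 = 1 := by simpa using h
      simp [h1, hb]
  have h := (Finset.card_le_card hsub).trans (Finset.card_union_le _ _)
  have h3 := card_circle_ne_zero_le h2
  have h4 := Finset.card_le_two (a := ((1 : F), (0 : F))) (b := (-1, 0))
  have h5 : 0 < Fintype.card F := Fintype.card_pos
  omega

theorem card_traceless_orthogonal_le (h2 : (2 : F) ≠ 0) {A : SL(2, F)} (hA : A.1.trace = 0) :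
    (Finset.univ.filter fun Z : SL(2, F) => Z.1.trace = 0 ∧ (A.1 * Z.1).trace = 0).card ≤
      Fintype.card F + 1 := by
  rcases Finset.eq_empty_or_nonempty
    (Finset.univ.filter fun Z : SL(2, F) => Z.1.trace = 0 ∧ (A.1 * Z.1).trace = 0)
    with h | ⟨Y, hY⟩
  · simp [h]
  have hY' : Y.1.trace = 0 ∧ (A.1 * Y.1).trace = 0 := by simpa using hY
  refine le_trans ?_ (card_circle_le h2)
  have anti : ∀ Z : SL(2, F), Z.1.trace = 0 ∧ (A.1 * Z.1).trace = 0 → A * Z = -(Z * A) := by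
    intro Z hZ
    apply Subtype.ext
    simpa using mul_eq_neg_mul_of_trace hA hZ.1 hZ.2
  have key : ∀ Z : SL(2, F), Z.1.trace = 0 ∧ (A.1 * Z.1).trace = 0 →
      ∃ v : F × F, v.1 ^ 2 + v.2 ^ 2 = 1 ∧ (Z * Y).1 = v.1 • 1 + v.2 • A.1 := by
    intro Z hZ
    have hcomm : Z * Y * A = A * (Z * Y) := by
      rw [← mul_assoc, anti Z hZ, mul_assoc, neg_mul, mul_assoc, anti Y hY', mul_neg, neg_neg]
    obtain ⟨a, b, h⟩ := exists_eq_smul_add_smul_of_commute h2 hA hcomm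
    exact ⟨(a, b), h⟩
  choose! f hf using key
  refine Finset.card_le_card_of_injOn f ?_ ?_
  · intro Z hZ
    have hZ' : Z.1.trace = 0 ∧ (A.1 * Z.1).trace = 0 := by simpa using hZ
    simpa using (hf Z hZ').1
  · intro Z hZ W hW h
    have hZ' : Z.1.trace = 0 ∧ (A.1 * Z.1).trace = 0 := by simpa using hZ
    have hW' : W.1.trace = 0 ∧ (A.1 * W.1).trace = 0 := by simpa using hW
    have h1 := (hf Z hZ').2
    rw [h, ← (hf W hW').2] at h1
    exact mul_right_cancel (Subtype.ext h1)

open Classical in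
theorem card_not_odd_orderOf_mul_le [Fintype (PSL2 F)] (h2 : (2 : F) ≠ 0) {i : PSL2 F}
    (hi : i ^ 2 = 1 ∧ i ≠ 1) :
    (Finset.univ.filter fun j : PSL2 F =>
      (j ^ 2 = 1 ∧ j ≠ 1) ∧ ¬ Odd (orderOf (i * j))).card * 4 ≤
      (Fintype.card F + 1) * (Fintype.card F - 1) := by
  obtain ⟨A, rfl⟩ := QuotientGroup.mk_surjective i
  have hA := (coe_isInvolution_iff h2 A).1 hi
  set T := Finset.univ.filter fun Z : SL(2, F) => Z.1.trace = 0 ∧ (A.1 * Z.1).trace = 0 with hT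
  set C := Finset.univ.filter fun v : F × F => v.1 ^ 2 + v.2 ^ 2 = 1 ∧ v.2 ≠ 0 with hC
  let r : PSL2 F → SL(2, F) × (F × F) → Prop := fun j x =>
    ∃ B : SL(2, F), (B : PSL2 F) = j ∧ (A * B).1 = x.2.1 • 1 + x.2.2 • x.1.1
  have hcount := Finset.card_mul_le_card_mul (m := 4) (n := 1)
    (s := Finset.univ.filter fun j : PSL2 F =>
      (j ^ 2 = 1 ∧ j ≠ 1) ∧ ¬ Odd (orderOf ((A : PSL2 F) * j))) (t := T ×ˢ C) r ?_ ?_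
  · refine hcount.trans ?_
    rw [mul_one, Finset.card_product]
    exact Nat.mul_le_mul (card_traceless_orthogonal_le h2 hA) (card_circle_ne_zero_le h2)
  · intro j hj
    obtain ⟨hj1, hj2⟩ := (Finset.mem_filter.1 hj).2
    obtain ⟨B, rfl⟩ := QuotientGroup.mk_surjective j
    obtain ⟨Z, a, b, hZ, ⟨hab, hb⟩, hX⟩ :=
      exists_of_not_odd_orderOf_mul h2 hA ((coe_isInvolution_iff h2 B).1 hj1) hj2
    have hnegZ : -Z ≠ Z := by
      intro h
      have hd := entries_det Z
      have e : ∀ k l, Z.1 k l = 0 := by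
        intro k l
        have h0 : -Z.1 k l = Z.1 k l := by
          rw [← Matrix.neg_apply, ← Matrix.SpecialLinearGroup.coe_neg, h]
        have : 2 * Z.1 k l = 0 := by linear_combination -h0
        simpa [h2] using this
      simp [e] at hd
    have hnegb : -b ≠ b := by
      intro h
      have : 2 * b = 0 := by linear_combination -h
      simp [h2, hb] at this
    have hBneg : ((-B : SL(2, F)) : PSL2 F) = B := (coe_eq_coe_iff _ _).2 (by simp)
    have hXneg : (A * -B).1 = (-a) • 1 + (-b) • Z.1 := by
      rw [mul_neg, Matrix.SpecialLinearGroup.coe_neg, hX]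
      module
    have hcard : ({(Z, (a, b)), (-Z, (a, -b)), (Z, (-a, -b)), (-Z, (-a, b))} :
        Finset (SL(2, F) × (F × F))).card = 4 := by
      rw [Finset.card_insert_of_notMem, Finset.card_insert_of_notMem,
        Finset.card_insert_of_notMem, Finset.card_singleton] <;>
      simp [hnegZ, hnegZ.symm, hnegb, hnegb.symm]
    rw [← hcard]
    apply Finset.card_le_card
    intro x hx
    simp only [Finset.mem_insert, Finset.mem_singleton] at hx
    rw [Finset.mem_bipartiteAbove]
    rcases hx with rfl | rfl | rfl | rfl
    · exact ⟨by simp [hT, hC, hZ, hab, hb], B, rfl, hX⟩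
    · exact ⟨by simp [hT, hC, hZ, hab, hb], B, rfl, by simpa using hX⟩
    · exact ⟨by simp [hT, hC, hZ, hab, hb], -B, hBneg, hXneg⟩
    · exact ⟨by simp [hT, hC, hZ, hab, hb], -B, hBneg, by simpa using hXneg⟩
  · intro x _
    rw [Finset.card_le_one]
    intro j hj j' hj'
    obtain ⟨B, rfl, hB⟩ := (Finset.mem_filter.1 hj).2
    obtain ⟨B', rfl, hB'⟩ := (Finset.mem_filter.1 hj').2
    have h : A * B = A * B' := Subtype.ext (hB.trans hB'.symm)
    rw [mul_left_cancel h]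

open Classical in
theorem card_mul_le_two_mul_card_involutions [Fintype (PSL2 F)] (h2 : (2 : F) ≠ 0) :
    Fintype.card F * (Fintype.card F - 1) ≤
      2 * (Finset.univ.filter fun g : PSL2 F => g ^ 2 = 1 ∧ g ≠ 1).card := by
  let m : F × Fˣ → SL(2, F) := fun x =>
    ⟨!![x.1, x.2; -(1 + x.1 ^ 2) / x.2, -x.1], by rw [det_fin_two_of]; field_simp; ring⟩
  have hm : Function.Injective m := by
    intro x y h
    have h00 : (m x).1 0 0 = (m y).1 0 0 := by rw [h]
    have h01 : (m x).1 0 1 = (m y).1 0 1 := by rw [h]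
    exact Prod.ext (by simpa [m] using h00) (Units.ext (by simpa [m] using h01))
  rw [← Fintype.card_units, ← Fintype.card_prod, ← Finset.card_univ]
  refine Finset.card_le_mul_card_image_of_maps_to (f := fun x => ((m x : SL(2, F)) : PSL2 F))
    ?_ 2 ?_
  · intro x _
    simp only [Finset.mem_filter, Finset.mem_univ, true_and]
    rw [coe_isInvolution_iff h2, trace_fin_two]
    simp [m]
  · intro g _
    obtain ⟨B, rfl⟩ := QuotientGroup.mk_surjective g
    refine le_trans (Finset.card_le_card_of_injOn m ?_ hm.injOn)
      (Finset.card_le_two (a := B) (b := -B))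
    intro x hx
    have hx' := (Finset.mem_filter.1 hx).2
    have := (coe_eq_coe_iff B (m x)).1 hx'.symm
    simpa using this

open Classical in
theorem card_involution_pairs_odd_orderOf [Fintype (PSL2 F)] (h2 : (2 : F) ≠ 0) :
    (Fintype.card F - 1) * (Finset.univ.filter fun g : PSL2 F => g ^ 2 = 1 ∧ g ≠ 1).card ^ 2 ≤
      2 * Fintype.card F * (Finset.univ.filter fun ij : PSL2 F × PSL2 F =>
        (ij.1 ^ 2 = 1 ∧ ij.1 ≠ 1) ∧ (ij.2 ^ 2 = 1 ∧ ij.2 ≠ 1) ∧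
          Odd (orderOf (ij.1 * ij.2))).card := by
  have hN := card_mul_le_two_mul_card_involutions h2
  set I := Finset.univ.filter fun g : PSL2 F => g ^ 2 = 1 ∧ g ≠ 1 with hI
  have hsplit := Finset.card_filter_add_card_filter_not (s := I ×ˢ I)
    (fun ij : PSL2 F × PSL2 F => Odd (orderOf (ij.1 * ij.2)))
  have hgood : (I ×ˢ I).filter (fun ij => Odd (orderOf (ij.1 * ij.2))) =
      Finset.univ.filter fun ij : PSL2 F × PSL2 F =>
        (ij.1 ^ 2 = 1 ∧ ij.1 ≠ 1) ∧ (ij.2 ^ 2 = 1 ∧ ij.2 ≠ 1) ∧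
          Odd (orderOf (ij.1 * ij.2)) := by
    ext ij
    simp [hI, and_assoc]
  have hbad : ((I ×ˢ I).filter (fun ij => ¬ Odd (orderOf (ij.1 * ij.2)))).card * 4 ≤
      I.card * ((Fintype.card F + 1) * (Fintype.card F - 1)) := by
    rw [Finset.card_filter, Finset.sum_product, Finset.sum_mul, ← smul_eq_mul,
      ← Finset.sum_const]
    refine Finset.sum_le_sum fun i hi => ?_
    rw [← Finset.card_filter]
    have := card_not_odd_orderOf_mul_le h2 (Finset.mem_filter.1 hi).2
    rwa [hI, Finset.filter_filter]
  rw [hgood, Finset.card_product] at hsplit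
  have hpos : 0 < Fintype.card F := Fintype.card_pos
  generalize Fintype.card F = q at *
  generalize I.card = N at *
  obtain ⟨r, rfl⟩ := Nat.exists_eq_add_one.2 hpos
  rw [Nat.add_sub_cancel] at *
  nlinarith [Nat.mul_le_mul_left (N * (r + 2)) hN, Nat.mul_le_mul_left (r + 1) hbad]

end Counting

end PSL2

/-- Lemma 2.3 of the paper: in `H = PSL₂(𝔽_q)`, `q ≥ 5` an odd prime power, the
number of ordered pairs of involutions whose product has odd order is at least
`(1/2 - 1/(2q))` times the square of the number `N` of involutions;
equivalently, `2q` times the number of such pairs is at least `(q-1) * N²`. -/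
theorem involution_pairs_odd_order_product_PSL2
    (p : ℕ) [Fact p.Prime] (hp : Odd p) (k : ℕ) (hk : 0 < k)
    (q : ℕ) (hq : q = p ^ k) (hq5 : 5 ≤ q)
    (N : ℕ) (hN : N = Nat.card {g : PSL2 (GaloisField p k) // g ^ 2 = 1 ∧ g ≠ 1}) :
    (q - 1) * N ^ 2 ≤
      2 * q * Nat.card {ij : PSL2 (GaloisField p k) × PSL2 (GaloisField p k) //
        (ij.1 ^ 2 = 1 ∧ ij.1 ≠ 1) ∧ (ij.2 ^ 2 = 1 ∧ ij.2 ≠ 1) ∧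
        Odd (orderOf (ij.1 * ij.2))} := by
  classical
  subst hN
  have hcard : Nat.card (GaloisField p k) = q := by rw [GaloisField.card p k hk.ne', hq]
  have : Fintype (GaloisField p k) := Fintype.ofFinite _
  have : Fintype (PSL2 (GaloisField p k)) := Fintype.ofFinite _
  have h2 : (2 : GaloisField p k) ≠ 0 := by
    have h := CharP.cast_eq_zero_iff (GaloisField p k) p 2
    intro h0
    have hdvd := h.1 (by exact_mod_cast h0)
    obtain rfl := (Nat.prime_dvd_prime_iff_eq Fact.out Nat.prime_two).1 hdvd
    exact absurd hp (by decide)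
  have h := PSL2.card_involution_pairs_odd_orderOf h2
  rw [← Nat.card_eq_fintype_card, hcard] at h
  rw [Nat.card_eq_fintype_card, Nat.card_eq_fintype_card, Fintype.card_subtype,
    Fintype.card_subtype]
  convert h
end
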